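/- (Kawashima's relation for multiple zeta values.) For any nonempty indices k, l and any integer m≥1: Σ_{p,q≥1, p+q=m} ζ( (1,…,1)_p ⊛ (k∨)⋆ ) · ζ( (1,…,1)_q ⊛ (l∨)⋆ ) = − ζ( (1,…,1)_m ⊛ ((k *̄ l)∨)⋆ ), where (1,…,1)_p denotes the index of p ones, ∨ denotes the Hoffman dual (extended ℚ-linearly), and ζ, ⊛, ⋆, *̄ are as defined below. -/

import Mathlib

open MeasureTheory Filter Topology

namespace Kawashima

/-- The set `A(k) = {k₁, k₁+k₂, …, k₁+⋯+k_{r-1}}` of proper nonempty partial sums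
of an index `k = (k₁, …, k_r)`. -/
def Aset (k : List ℕ) : Finset ℕ :=
  (Finset.Ico 1 k.length).image (fun i => (k.take i).sum)

/-- The Hoffman dual of an index `k`: the unique index `k∨` with the same weight such
that `A(k)` and `A(k∨)` partition `{1, …, wt(k) - 1}`.  It is computed here as the
composition of `wt(k)` whose partial-sum set is the complement of `A(k)`. -/
def hdual (k : List ℕ) : List ℕ :=
  let w := k.sum
  let L := (insert w ((Finset.Icc 1 (w - 1)) \ Aset k)).sort (· ≤ ·)
  L.zipWith (fun a b => a - b) (0 :: L)

/-- `sStar k N = s⋆(k, N) = Σ_{0 < m₁ ≤ ⋯ ≤ m_{r-1} ≤ m_r = N} 1/(m₁^{k₁} ⋯ m_r^{k_r})`.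
For the empty index the value is `1` (empty product), and for a nonempty index and
`N = 0` the value is `0` (empty sum). -/
noncomputable def sStar (k : List ℕ) (N : ℕ) : ℝ :=
  ∑ m : Fin k.length → Fin (N + 1),
    if (∀ i, 0 < (m i : ℕ)) ∧
       (∀ i j : Fin k.length, i ≤ j → (m i : ℕ) ≤ (m j : ℕ)) ∧
       (∀ i : Fin k.length, (i : ℕ) + 1 = k.length → (m i : ℕ) = N)
    then ∏ i : Fin k.length, 1 / ((m i : ℕ) : ℝ) ^ k.get i
    else 0

/-- `SStar k N = S⋆(k, N) = Σ_{n=1}^N s⋆(k, n)`. -/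
noncomputable def SStar (k : List ℕ) (N : ℕ) : ℝ :=
  ∑ n ∈ Finset.Icc 1 N, sStar k n

/-- The binomial coefficient `binom(z, n) = z(z-1)⋯(z-n+1)/n!` for complex `z`. -/
noncomputable def cbinom (z : ℂ) (n : ℕ) : ℂ :=
  (descPochhammer ℂ n).eval z / (n.factorial : ℂ)

/-- The Kawashima function
`F_k(z) = Σ_{n=1}^∞ (-1)^{n-1} s⋆(k∨, n) binom(z, n)`, with `F_∅(z) = 1`. -/
noncomputable def F (k : List ℕ) (z : ℂ) : ℂ :=
  if k = [] then 1
  else ∑' n : ℕ, (-1 : ℂ) ^ n * ((sStar (hdual k) (n + 1) : ℝ) : ℂ) * cbinom z (n + 1)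

/-- The domain `Δ(k) ⊆ (0,1)^{wt(k)}`: `t_j < t_{j+1}` if `j ∈ A(k)` and
`t_j > t_{j+1}` otherwise (positions `1`-indexed). -/
def Delta (k : List ℕ) : Set (Fin k.sum → ℝ) :=
  {t | (∀ j, t j ∈ Set.Ioo (0 : ℝ) 1) ∧
       ∀ (i : Fin k.sum) (h : (i : ℕ) + 1 < k.sum),
         if (i : ℕ) + 1 ∈ Aset k then t i < t ⟨(i : ℕ) + 1, h⟩
         else t ⟨(i : ℕ) + 1, h⟩ < t i}

/-- The multiple zeta value `ζ(k) = Σ_{0 < m₁ < ⋯ < m_r} 1/(m₁^{k₁} ⋯ m_r^{k_r})`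
(as a `tsum`; it converges for admissible `k`), with `ζ(∅) = 1`. -/
noncomputable def mzv (k : List ℕ) : ℝ :=
  ∑' m : Fin k.length → ℕ,
    if (∀ i, 0 < m i) ∧ (∀ i j : Fin k.length, i < j → m i < m j)
    then ∏ i : Fin k.length, 1 / ((m i : ℕ) : ℝ) ^ k.get i
    else 0

/-- `ζ` extended `ℚ`-linearly to formal `ℚ`-linear combinations of indices. -/
noncomputable def zetaL (v : List ℕ →₀ ℚ) : ℝ :=
  v.sum fun k a => (a : ℝ) * mzv k

/-- The Kawashima function extended `ℚ`-linearly to formal combinations of indices. -/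
noncomputable def FL (v : List ℕ →₀ ℚ) (z : ℂ) : ℂ :=
  v.sum fun k a => (a : ℂ) * F k z

/-- Auxiliary harmonic product, on *reversed* indices (so that the rightmost entry of
the index is the head of the list):
`k * l = (k₋ * l, k_r) + (k * l₋, l_s) + (k₋ * l₋, k_r + l_s)`. -/
noncomputable def hstarAux : List ℕ → List ℕ → (List ℕ →₀ ℚ)
  | [], l => Finsupp.single l 1
  | a :: k, [] => Finsupp.single (a :: k) 1
  | a :: k, b :: l =>
      Finsupp.mapDomain (List.cons a) (hstarAux k (b :: l)) +
      Finsupp.mapDomain (List.cons b) (hstarAux (a :: k) l) +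
      Finsupp.mapDomain (List.cons (a + b)) (hstarAux k l)
  termination_by k l => k.length + l.length

/-- The harmonic product `k * l` of two indices, as a `ℚ`-linear combination of
indices. -/
noncomputable def hstar (k l : List ℕ) : List ℕ →₀ ℚ :=
  Finsupp.mapDomain List.reverse (hstarAux k.reverse l.reverse)

/-- Auxiliary product `*̄` on reversed indices:
`k *̄ l = (k₋ *̄ l, k_r) + (k *̄ l₋, l_s) - (k₋ *̄ l₋, k_r + l_s)`. -/
noncomputable def hbarAux : List ℕ → List ℕ → (List ℕ →₀ ℚ)
  | [], l => Finsupp.single l 1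
  | a :: k, [] => Finsupp.single (a :: k) 1
  | a :: k, b :: l =>
      Finsupp.mapDomain (List.cons a) (hbarAux k (b :: l)) +
      Finsupp.mapDomain (List.cons b) (hbarAux (a :: k) l) -
      Finsupp.mapDomain (List.cons (a + b)) (hbarAux k l)
  termination_by k l => k.length + l.length

/-- The harmonic product `k *̄ l` of two indices. -/
noncomputable def hbar (k l : List ℕ) : List ℕ →₀ ℚ :=
  Finsupp.mapDomain List.reverse (hbarAux k.reverse l.reverse)

/-- The product `k ⊛ l = (k₋ * l₋, k_r + l_s)` for nonempty indices `k`, `l`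
(and `0` if either is empty). -/
noncomputable def circAst (k l : List ℕ) : List ℕ →₀ ℚ :=
  match k.reverse, l.reverse with
  | a :: k', b :: l' =>
      Finsupp.mapDomain List.reverse
        (Finsupp.mapDomain (List.cons (a + b)) (hstarAux k' l'))
  | _, _ => 0

/-- `⊛` extended bilinearly to formal combinations. -/
noncomputable def circAstL (v w : List ℕ →₀ ℚ) : List ℕ →₀ ℚ :=
  v.sum fun k a => w.sum fun l b => (a * b) • circAst k l

/-- The star operator `k ↦ k⋆`: the sum over all ways to replace commas by pluses
in groups of consecutive entries,
`(k₁,…,k_r)⋆ = Σ_{0<j₁<⋯<j_q=r} (k₁+⋯+k_{j₁}, …, k_{j_{q-1}+1}+⋯+k_{j_q})`. -/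
noncomputable def starOp : List ℕ → (List ℕ →₀ ℚ)
  | [] => Finsupp.single [] 1
  | [a] => Finsupp.single [a] 1
  | a :: b :: k =>
      Finsupp.mapDomain (List.cons a) (starOp (b :: k)) + starOp ((a + b) :: k)
  termination_by k => k.length

/-- The star operator extended `ℚ`-linearly. -/
noncomputable def starL (v : List ℕ →₀ ℚ) : List ℕ →₀ ℚ :=
  v.sum fun k a => a • starOp k

open Classical in
/-- Kawashima's function `G_k(z)`: the sum over tuples `0 < n₁, …, n_w` with
`n_j < n_{j+1}` if `j ∉ A(k)` and `n_j ≤ n_{j+1}` if `j ∈ A(k)`, of the product of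
the factors `1/(n_j + z)` at positions `j ∈ A(k)`, the factor
`1/n_w - 1/(n_w + z)` at the last position, and `1/n_j` elsewhere. -/
noncomputable def G (k : List ℕ) (z : ℂ) : ℂ :=
  ∑' n : Fin k.sum → ℕ,
    if (∀ j, 0 < n j) ∧
       (∀ (i : Fin k.sum) (h : (i : ℕ) + 1 < k.sum),
          if (i : ℕ) + 1 ∈ Aset k then n i ≤ n ⟨(i : ℕ) + 1, h⟩
          else n i < n ⟨(i : ℕ) + 1, h⟩)
    then ∏ j : Fin k.sum,
      if (j : ℕ) + 1 = k.sum then 1 / ((n j : ℕ) : ℂ) - 1 / (((n j : ℕ) : ℂ) + z)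
      else if (j : ℕ) + 1 ∈ Aset k then 1 / (((n j : ℕ) : ℂ) + z)
      else 1 / ((n j : ℕ) : ℂ)
    else 0

open Classical in
/-- `ζ_k(l) = Σ 1/(n₁^{l₁} ⋯ n_w^{l_w})`, summed over the same set of tuples as in
the definition of `G_k`. -/
noncomputable def zetaIdx (k : List ℕ) (l : List ℕ) : ℝ :=
  ∑' n : Fin k.sum → ℕ,
    if (∀ j, 0 < n j) ∧
       (∀ (i : Fin k.sum) (h : (i : ℕ) + 1 < k.sum),
          if (i : ℕ) + 1 ∈ Aset k then n i ≤ n ⟨(i : ℕ) + 1, h⟩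
          else n i < n ⟨(i : ℕ) + 1, h⟩)
    then ∏ j : Fin k.sum, 1 / ((n j : ℕ) : ℝ) ^ (l.getD (j : ℕ) 0)
    else 0

/-- `C_m(k) = Σ_{l₁,…,l_{r-1} ≥ 0, l_r ≥ 1, l₁+⋯+l_r = m}
ζ_k(1,…,1 (k₁-1 ones), l₁+1, …, 1,…,1 (k_r-1 ones), l_r+1)`. -/
noncomputable def Cm (k : List ℕ) (m : ℕ) : ℝ :=
  ∑ l : Fin k.length → Fin (m + 1),
    if (∑ i, (l i : ℕ)) = m ∧
       (∀ i : Fin k.length, (i : ℕ) + 1 = k.length → 1 ≤ (l i : ℕ))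
    then zetaIdx k
      ((List.ofFn (fun i : Fin k.length =>
          List.replicate (k.get i - 1) 1 ++ [(l i : ℕ) + 1])).flatten)
    else 0

/-- The iterated integral `A_m(k)` over `Δ((k,1,…,1))` (`m` trailing ones) of
`ω_{δ(1)}(t₁) ⋯ ω_{δ(w-1)}(t_{w-1}) · dt_w/(1-t_w) · dt_{w+1}/t_{w+1} ⋯ dt_{w+m}/t_{w+m}`. -/
noncomputable def Aint (k : List ℕ) (m : ℕ) : ℝ :=
  ∫ t in Delta (k ++ List.replicate m 1),
    ∏ i : Fin (k ++ List.replicate m 1).sum,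
      if (i : ℕ) + 1 < k.sum then
        (if (i : ℕ) + 1 ∈ Aset k then 1 / (1 - t i) else 1 / t i)
      else if (i : ℕ) + 1 = k.sum then 1 / (1 - t i)
      else 1 / t i

/-- The digamma function `ψ(z) = Γ'(z)/Γ(z)`. -/
noncomputable def digamma (z : ℂ) : ℂ := deriv Complex.Gamma z / Complex.Gamma z

/-- The table of iterated differences of the sequence of star sums attached to a word. -/
noncomputable def diffTable : List Bool → ℕ → ℕ → ℝ
  | [], N, n => (N.factorial * n.factorial : ℝ) / ((N + n + 1).factorial : ℝ)
  | true :: w, 0, n => diffTable w 0 n / (n + 1)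
  | true :: w, N + 1, n =>
      ((N + 1) * diffTable (true :: w) N n + diffTable w (N + 1) n) / (N + n + 2)
  | false :: w, N, 0 => diffTable w N 0 / (N + 1)
  | false :: w, N, n + 1 =>
      ((n + 1) * diffTable (false :: w) N n + diffTable w N (n + 1)) / (N + n + 2)
  termination_by w N n => (w.length, N, n)

theorem diffTable_swap (w : List Bool) (N n : ℕ) :
    diffTable (w.map not) N n = diffTable w n N := by
  induction w generalizing N n with
  | nil => simp only [List.map_nil, diffTable]; rw [mul_comm, add_comm N n]
  | cons b w ih =>
    cases b with
    | true =>
      induction n with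
      | zero => simp only [List.map_cons, Bool.not_true, diffTable, ih]
      | succ n ihn =>
        simp only [List.map_cons, Bool.not_true] at ihn ⊢
        rw [diffTable, diffTable, ihn, ih]; ring
    | false =>
      induction N with
      | zero => simp only [List.map_cons, Bool.not_false, diffTable, ih]
      | succ N ihn =>
        simp only [List.map_cons, Bool.not_false] at ihn ⊢
        rw [diffTable, diffTable, ihn, ih]; ring

theorem diffTable_nonneg (w : List Bool) (N n : ℕ) : 0 ≤ diffTable w N n := by
  induction w generalizing N n with
  | nil => rw [diffTable]; positivity
  | cons b w ih =>
    cases b with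
    | true =>
      induction N with
      | zero => rw [diffTable]; have := ih 0 n; positivity
      | succ N ihn => rw [diffTable]; have := ih (N + 1) n; positivity
    | false =>
      induction n with
      | zero => rw [diffTable]; have := ih N 0; positivity
      | succ n ihn => rw [diffTable]; have := ih N (n + 1); positivity

theorem diffTable_nil_succ_right (N n : ℕ) :
    (N + n + 2) * diffTable [] N (n + 1) = (n + 1) * diffTable [] N n := by
  simp only [diffTable]
  rw [show N + (n + 1) + 1 = (N + n + 1) + 1 by ring, Nat.factorial_succ (N + n + 1),
    Nat.factorial_succ n]
  have := Nat.factorial_pos (N + n + 1)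
  push_cast
  field_simp
  ring

theorem diffTable_true_succ_left (w : List Bool) (N n : ℕ) :
    (N + n + 2) * diffTable (true :: w) (N + 1) n =
      (N + 1) * diffTable (true :: w) N n + diffTable w (N + 1) n := by
  rw [diffTable]; field_simp

theorem diffTable_false_succ_right (w : List Bool) (N n : ℕ) :
    (N + n + 2) * diffTable (false :: w) N (n + 1) =
      (n + 1) * diffTable (false :: w) N n + diffTable w N (n + 1) := by
  rw [diffTable]; field_simp

theorem diffTable_true_zero_left (w : List Bool) (n : ℕ) :
    (n + 1) * diffTable (true :: w) 0 n = diffTable w 0 n := by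
  rw [diffTable]; field_simp

theorem diffTable_false_zero_right (w : List Bool) (N : ℕ) :
    (N + 1) * diffTable (false :: w) N 0 = diffTable w N 0 := by
  rw [diffTable]; field_simp

theorem diffTable_pascal_true {w : List Bool}
    (h : ∀ N n, diffTable w (N + 1) n + diffTable w N (n + 1) = diffTable w N n) (N n : ℕ) :
    diffTable (true :: w) (N + 1) n + diffTable (true :: w) N (n + 1)
      = diffTable (true :: w) N n := by
  induction N generalizing n with
  | zero =>
    have h1 := diffTable_true_succ_left w 0 n
    have h2 := diffTable_true_zero_left w (n + 1)
    have h3 := diffTable_true_zero_left w n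
    have h4 := h 0 n
    push_cast at h1 h2
    have : (0 : ℝ) < n + 2 := by positivity
    apply mul_left_cancel₀ this.ne'
    linear_combination h1 + h2 + h4 - h3
  | succ N ih =>
    have h1 := diffTable_true_succ_left w (N + 1) n
    have h2 := diffTable_true_succ_left w N (n + 1)
    have h3 := diffTable_true_succ_left w N n
    have h4 := h (N + 1) n
    have h5 := ih n
    push_cast at h1 h2 h3
    have : (0 : ℝ) < N + n + 3 := by positivity
    apply mul_left_cancel₀ this.ne'
    linear_combination h1 + h2 + h4 - h3 + (N + 1) * h5

theorem diffTable_pascal (w : List Bool) (N n : ℕ) :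
    diffTable w (N + 1) n + diffTable w N (n + 1) = diffTable w N n := by
  induction w generalizing N n with
  | nil =>
    have h1 := diffTable_nil_succ_right N n
    have h2 := diffTable_nil_succ_right n N
    have hs := fun a b => diffTable_swap [] a b
    simp only [List.map_nil] at hs
    rw [hs n (N + 1), hs n N] at h2
    have : (0 : ℝ) < N + n + 2 := by positivity
    apply mul_left_cancel₀ this.ne'
    linear_combination h1 + h2
  | cons b w ih =>
    cases b with
    | true => exact diffTable_pascal_true ih N n
    | false =>
      have := diffTable_pascal_true (w := w.map not)
        (fun N n => by simp only [diffTable_swap]; rw [add_comm]; exact ih n N) n N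
      have e : true :: w.map not = (false :: w).map not := rfl
      simp only [e, diffTable_swap] at this
      linarith

theorem sum_diffTable_left (w : List Bool) (N : ℕ) :
    (N + 1) * diffTable (true :: w) N 0 = ∑ i ∈ Finset.range (N + 1), diffTable w i 0 := by
  induction N with
  | zero => have := diffTable_true_zero_left w 0; simpa using this
  | succ N ih =>
    rw [Finset.sum_range_succ, ← ih]
    have := diffTable_true_succ_left w N 0
    push_cast at this ⊢
    linear_combination this

theorem diffTable_le_left_zero (w : List Bool) (N n : ℕ) :
    diffTable w N n ≤ diffTable w 0 n := by
  induction N with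
  | zero => exact le_rfl
  | succ N ih =>
    have := diffTable_pascal w N n
    have := diffTable_nonneg w N (n + 1)
    linarith

theorem diffTable_le_right_zero (w : List Bool) (N n : ℕ) :
    diffTable w N n ≤ diffTable w N 0 := by
  have := diffTable_le_left_zero (w.map not) n N
  simpa only [diffTable_swap] using this

/-- The `n`-th harmonic number as a real number. -/
noncomputable def harm (n : ℕ) : ℝ := ∑ i ∈ Finset.range n, 1 / ((i : ℝ) + 1)

theorem harm_succ (n : ℕ) : harm (n + 1) = harm n + 1 / ((n : ℝ) + 1) :=
  Finset.sum_range_succ _ _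

theorem harm_nonneg (n : ℕ) : 0 ≤ harm n := Finset.sum_nonneg fun _ _ => by positivity

theorem harm_mono : Monotone harm :=
  monotone_nat_of_le_succ fun n => by
    rw [harm_succ]; have : (0 : ℝ) ≤ 1 / ((n : ℝ) + 1) := by positivity
    linarith

theorem one_le_harm_succ (n : ℕ) : 1 ≤ harm (n + 1) := by
  have := harm_mono (show 1 ≤ n + 1 by omega)
  simpa [harm] using this

theorem sum_harm_pow_div_le (d n : ℕ) :
    ∑ i ∈ Finset.range n, harm (i + 1) ^ d / ((i : ℝ) + 1) ≤ harm n ^ (d + 1) := by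
  calc ∑ i ∈ Finset.range n, harm (i + 1) ^ d / ((i : ℝ) + 1)
      ≤ ∑ i ∈ Finset.range n, harm n ^ d * (1 / ((i : ℝ) + 1)) := by
        refine Finset.sum_le_sum fun i hi => ?_
        rw [mul_one_div]
        gcongr
        · exact harm_nonneg _
        · exact harm_mono (by simpa using hi)
    _ = harm n ^ (d + 1) := by rw [← Finset.mul_sum, pow_succ]; rfl

theorem diffTable_left_le (w : List Bool) (N : ℕ) :
    diffTable w N 0 ≤ harm (N + 1) ^ w.length / ((N : ℝ) + 1) := by
  induction w generalizing N with
  | nil =>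
    simp only [diffTable, List.length_nil, pow_zero, add_zero]
    rw [Nat.factorial_succ]
    have := Nat.factorial_pos N
    apply le_of_eq
    push_cast
    field_simp
    simp
  | cons b w ih =>
    rw [le_div_iff₀ (by positivity), mul_comm, List.length_cons]
    cases b with
    | true =>
      rw [sum_diffTable_left]
      exact (Finset.sum_le_sum fun i _ => ih i).trans (sum_harm_pow_div_le _ _)
    | false =>
      rw [diffTable_false_zero_right]
      refine (ih N).trans ?_
      have h1 := one_le_harm_succ N
      have : (0 : ℝ) ≤ N := by positivity
      calc harm (N + 1) ^ w.length / ((N : ℝ) + 1) ≤ harm (N + 1) ^ w.length / 1 := by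
            gcongr; linarith
        _ ≤ _ := by rw [div_one]; exact pow_le_pow_right₀ h1 (by omega)

theorem diffTable_right_le (w : List Bool) (n : ℕ) :
    diffTable w 0 n ≤ harm (n + 1) ^ w.length / ((n : ℝ) + 1) := by
  have := diffTable_left_le (w.map not) n
  simpa [diffTable_swap] using this

theorem exists_harm_pow_le (d : ℕ) :
    ∃ C : ℝ, 0 ≤ C ∧ ∀ n : ℕ, harm (n + 1) ^ d ≤ C * ((n : ℝ) + 1) ^ (1 / 4 : ℝ) := by
  set r : ℝ := 1 / (4 * ((d : ℝ) + 1)) with hr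
  have hr0 : 0 < r := by positivity
  have hrd : r * d ≤ 1 / 4 := by
    rw [hr, div_mul_eq_mul_div, div_le_div_iff₀ (by positivity) (by norm_num)]
    linarith
  refine ⟨(1 + 1 / r) ^ d, by positivity, fun n => ?_⟩
  have hn : (1 : ℝ) ≤ (n : ℝ) + 1 := by linarith [n.cast_nonneg (α := ℝ)]
  have h1 : harm (n + 1) ≤ 1 + Real.log ((n : ℝ) + 1) := by
    have := harmonic_le_one_add_log (n + 1)
    simp only [harmonic] at this
    push_cast at this
    simpa [harm] using this
  have h2 := Real.log_le_rpow_div (by linarith : (0 : ℝ) ≤ (n : ℝ) + 1) hr0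
  have h3 : 1 ≤ ((n : ℝ) + 1) ^ r := Real.one_le_rpow hn hr0.le
  have h4 : harm (n + 1) ≤ (1 + 1 / r) * ((n : ℝ) + 1) ^ r := by
    rw [add_mul, one_mul, one_div_mul_eq_div]; linarith
  calc harm (n + 1) ^ d ≤ ((1 + 1 / r) * ((n : ℝ) + 1) ^ r) ^ d :=
        pow_le_pow_left₀ (harm_nonneg _) h4 d
    _ = (1 + 1 / r) ^ d * ((n : ℝ) + 1) ^ (r * d) := by
        rw [mul_pow, ← Real.rpow_natCast (((n : ℝ) + 1) ^ r) d, ← Real.rpow_mul (by linarith)]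
    _ ≤ _ := by gcongr

theorem tendsto_harm_pow_div (d : ℕ) :
    Tendsto (fun n : ℕ => harm (n + 1) ^ d / ((n : ℝ) + 1)) atTop (𝓝 0) := by
  obtain ⟨C, hC0, hC⟩ := exists_harm_pow_le d
  have h1 : Tendsto (fun n : ℕ => C * ((n : ℝ) + 1) ^ (-(3 / 4) : ℝ)) atTop (𝓝 0) := by
    have := (tendsto_rpow_neg_atTop (by norm_num : (0 : ℝ) < 3 / 4)).comp
      (tendsto_atTop_add_const_right atTop (1 : ℝ) (tendsto_natCast_atTop_atTop (R := ℝ)))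
    simpa using this.const_mul C
  refine squeeze_zero (fun n => ?_) (fun n => ?_) h1
  · have := harm_nonneg (n + 1); positivity
  · have hn : (0 : ℝ) < (n : ℝ) + 1 := by positivity
    rw [div_le_iff₀ hn, mul_assoc, ← Real.rpow_add_one hn.ne']
    have h := hC n
    rwa [show (1 / 4 : ℝ) = -(3 / 4) + 1 by norm_num] at h

theorem tendsto_diffTable_right (w : List Bool) (N : ℕ) :
    Tendsto (fun n => diffTable w N n) atTop (𝓝 0) :=
  squeeze_zero (fun _ => diffTable_nonneg _ _ _)
    (fun n => (diffTable_le_left_zero w N n).trans (diffTable_right_le w n))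
    (tendsto_harm_pow_div _)

/-- The signed binomial coefficient `(-1)^n binom(x, n)`. -/
noncomputable def sbinom (x : ℝ) : ℕ → ℝ
  | 0 => 1
  | n + 1 => sbinom x n * (n - x) / (n + 1)

theorem succ_mul_sbinom_succ (x : ℝ) (n : ℕ) :
    (n + 1) * sbinom x (n + 1) = (n - x) * sbinom x n := by
  rw [sbinom]; field_simp

theorem sbinom_one (x : ℝ) : sbinom x 1 = -x := by simp [sbinom]

theorem sbinom_succ_eq_prod (x : ℝ) (n : ℕ) :
    -sbinom x (n + 1) = x / (n + 1) * ∏ j ∈ Finset.range n, (1 - x / (j + 1)) := by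
  induction n with
  | zero => simp [sbinom_one]
  | succ n ih =>
    have h := succ_mul_sbinom_succ x (n + 1)
    rw [Finset.prod_range_succ]
    have h2 : -sbinom x (n + 1 + 1) = -sbinom x (n + 1) * (n + 1 - x) / (n + 1 + 1) := by
      rw [sbinom]; push_cast; ring
    rw [h2, ih]
    push_cast
    field_simp

theorem sbinom_succ_nonpos {x : ℝ} (h0 : 0 ≤ x) (h1 : x ≤ 1) (n : ℕ) :
    0 ≤ -sbinom x (n + 1) := by
  rw [sbinom_succ_eq_prod]
  refine mul_nonneg (by positivity) (Finset.prod_nonneg fun j _ => ?_)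
  rw [sub_nonneg, div_le_one (by positivity)]
  linarith [j.cast_nonneg (α := ℝ)]

theorem sum_sbinom (x : ℝ) (n : ℕ) :
    ∑ i ∈ Finset.range n, -sbinom x (i + 1) = 1 - ∏ j ∈ Finset.range n, (1 - x / (j + 1)) := by
  induction n with
  | zero => simp
  | succ n ih =>
    rw [Finset.sum_range_succ, ih, sbinom_succ_eq_prod, Finset.prod_range_succ]
    field_simp
    ring

theorem prod_one_sub_nonneg {x : ℝ} (h1 : x ≤ 1) (n : ℕ) :
    0 ≤ ∏ j ∈ Finset.range n, (1 - x / ((j : ℝ) + 1)) := by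
  refine Finset.prod_nonneg fun j _ => ?_
  rw [sub_nonneg, div_le_one (by positivity)]
  linarith [j.cast_nonneg (α := ℝ)]

theorem prod_one_sub_le_one {x : ℝ} (h0 : 0 ≤ x) (h1 : x ≤ 1) (n : ℕ) :
    ∏ j ∈ Finset.range n, (1 - x / ((j : ℝ) + 1)) ≤ 1 := by
  refine Finset.prod_le_one (fun j _ => ?_) fun j _ => ?_
  · rw [sub_nonneg, div_le_one (by positivity)]
    linarith [j.cast_nonneg (α := ℝ)]
  · have : 0 ≤ x / ((j : ℝ) + 1) := by positivity
    linarith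

theorem summable_sbinom {x : ℝ} (h0 : 0 ≤ x) (h1 : x ≤ 1) :
    Summable fun n => -sbinom x (n + 1) :=
  summable_of_sum_range_le (c := 1) (sbinom_succ_nonpos h0 h1) fun n => by
    rw [sum_sbinom]; linarith [prod_one_sub_nonneg h1 n]

theorem tsum_sbinom_le {x : ℝ} (h0 : 0 ≤ x) (h1 : x ≤ 1) : ∑' n, -sbinom x (n + 1) ≤ 1 :=
  Real.tsum_le_of_sum_range_le (sbinom_succ_nonpos h0 h1) fun n => by
    rw [sum_sbinom]; linarith [prod_one_sub_nonneg h1 n]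

theorem succ_mul_sbinom_le {x : ℝ} (h0 : 0 ≤ x) (h1 : x ≤ 1) (n : ℕ) :
    (n + 1) * -sbinom x (n + 1) ≤ 1 := by
  rw [sbinom_succ_eq_prod, ← mul_assoc, mul_div_cancel₀ _ (by positivity)]
  exact mul_le_one₀ h1 (prod_one_sub_nonneg h1 n) (prod_one_sub_le_one h0 h1 n)

theorem summable_mul_sbinom {x : ℝ} (h0 : 0 ≤ x) (h1 : x ≤ 1) (w : List Bool) (N : ℕ) :
    Summable fun n => diffTable w N n * -sbinom x (n + 1) := by
  refine Summable.of_nonneg_of_le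
    (fun n => mul_nonneg (diffTable_nonneg _ _ _) (sbinom_succ_nonpos h0 h1 n))
    (fun n => mul_le_mul_of_nonneg_right ?_ (sbinom_succ_nonpos h0 h1 n))
    ((summable_sbinom h0 h1).mul_left (harm 1 ^ w.length))
  have h : Antitone (diffTable w 0) := antitone_nat_of_succ_le fun n => by
    have := diffTable_pascal w 0 n
    have := diffTable_nonneg w (0 + 1) n
    linarith
  refine ((diffTable_le_left_zero w N n).trans (h (Nat.zero_le n))).trans ?_
  simpa using diffTable_left_le w 0

theorem summable_mul_sbinom' {x : ℝ} (h0 : 0 ≤ x) (h1 : x ≤ 1) (w : List Bool) (N : ℕ) :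
    Summable fun n => diffTable w N n * sbinom x n := by
  rw [← summable_nat_add_iff 1]
  have h := summable_mul_sbinom h0 h1 w N
  have h' := summable_mul_sbinom h0 h1 w (N + 1)
  convert (h.sub h').neg using 2 with n
  have := diffTable_pascal w N n
  rw [← this]; ring

/-- The Newton interpolation `N + x ↦ F(N + x)` of the star sums attached to a word. -/
noncomputable def newton (w : List Bool) (N : ℕ) (x : ℝ) : ℝ :=
  ∑ i ∈ Finset.range N, diffTable w i 0 + ∑' n, diffTable w N n * -sbinom x (n + 1)

/-- The backward difference of the Newton interpolation at `N + 1 + x`. -/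
noncomputable def newtonDiff (w : List Bool) (N : ℕ) (x : ℝ) : ℝ :=
  ∑' n, diffTable w N n * sbinom x n

theorem newton_succ_sub {x : ℝ} (h0 : 0 ≤ x) (h1 : x ≤ 1) (w : List Bool) (N : ℕ) :
    newton w (N + 1) x - newton w N x = newtonDiff w N x := by
  have h := summable_mul_sbinom h0 h1 w N
  have h' := summable_mul_sbinom h0 h1 w (N + 1)
  rw [newtonDiff, (summable_mul_sbinom' h0 h1 w N).tsum_eq_zero_add, newton, newton,
    Finset.sum_range_succ, show sbinom x 0 = 1 from rfl]
  have : ∑' n, diffTable w N (n + 1) * sbinom x (n + 1) =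
      ∑' n, diffTable w (N + 1) n * -sbinom x (n + 1)
        - ∑' n, diffTable w N n * -sbinom x (n + 1) := by
    rw [← h'.tsum_sub h]
    congr 1 with n
    have := diffTable_pascal w N n
    rw [← this]; ring
  rw [this]; ring

/-- Multiplication of a Newton series by `x + y`, on the level of coefficients. -/
theorem tsum_shift_sbinom {x y : ℝ} (h0 : 0 ≤ x) (h1 : x ≤ 1) {c d : ℕ → ℝ}
    (hc0 : Tendsto c atTop (𝓝 0)) (hc : Summable fun n => c n * sbinom x n)
    (hd : Summable fun n => d n * sbinom x n) (hd0 : d 0 = y * c 0)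
    (hd1 : ∀ n : ℕ, d (n + 1) = (n + 1 + y) * c (n + 1) - (n + 1) * c n) :
    (x + y) * ∑' n, c n * sbinom x n = ∑' n, d n * sbinom x n := by
  have key : ∀ n : ℕ, ∑ i ∈ Finset.range (n + 1), d i * sbinom x i =
      (x + y) * ∑ i ∈ Finset.range (n + 1), c i * sbinom x i
        + c n * ((n + 1) * sbinom x (n + 1)) := by
    intro n
    induction n with
    | zero => simp [sbinom_one, hd0, show sbinom x 0 = 1 from rfl]; ring
    | succ n ih =>
      rw [Finset.sum_range_succ, ih, Finset.sum_range_succ _ (n + 1), hd1]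
      have := succ_mul_sbinom_succ x (n + 1)
      push_cast at this ⊢
      rw [this]; ring
  have hz : Tendsto (fun n : ℕ => c n * ((n + 1) * sbinom x (n + 1))) atTop (𝓝 0) := by
    refine squeeze_zero_norm (fun n => ?_) (tendsto_zero_iff_norm_tendsto_zero.1 hc0)
    rw [norm_mul]
    refine mul_le_of_le_one_right (norm_nonneg _) ?_
    have h2 := succ_mul_sbinom_le h0 h1 n
    have h3 := sbinom_succ_nonpos h0 h1 n
    rw [Real.norm_eq_abs, abs_le]
    have : (0 : ℝ) ≤ (n + 1) * -sbinom x (n + 1) := by positivity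
    constructor <;> nlinarith
  have hc' := (tendsto_add_atTop_iff_nat 1).2 hc.hasSum.tendsto_sum_nat
  have hd' := (tendsto_add_atTop_iff_nat 1).2 hd.hasSum.tendsto_sum_nat
  refine tendsto_nhds_unique ?_ hd'
  simp only [key]
  simpa using (hc'.const_mul (x + y)).add hz

theorem newtonDiff_nil {x : ℝ} (h0 : 0 ≤ x) (h1 : x ≤ 1) (N : ℕ) :
    (x + (N + 1)) * newtonDiff [] N x = 1 := by
  rw [newtonDiff, tsum_shift_sbinom (d := fun n => if n = 0 then (N + 1) * diffTable [] N 0 else 0)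
    h0 h1 (tendsto_diffTable_right _ _) (summable_mul_sbinom' h0 h1 _ _)]
  · rw [tsum_eq_single 0 (fun n hn => by simp [hn])]
    have := Nat.factorial_pos N
    simp only [diffTable, sbinom, if_true, add_zero, Nat.factorial_succ]
    push_cast
    field_simp
    simp
  · exact summable_of_ne_finset_zero (s := {0}) (fun n hn => by simp at hn; simp [hn])
  · simp
  · intro n
    have := diffTable_nil_succ_right N n
    simp only [Nat.add_eq_zero_iff, one_ne_zero, and_false, if_false]
    linarith

theorem newtonDiff_false {x : ℝ} (h0 : 0 ≤ x) (h1 : x ≤ 1) (w : List Bool) (N : ℕ) :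
    (x + (N + 1)) * newtonDiff (false :: w) N x = newtonDiff w N x := by
  refine tsum_shift_sbinom h0 h1 (tendsto_diffTable_right _ _) (summable_mul_sbinom' h0 h1 _ _)
    (summable_mul_sbinom' h0 h1 _ _) (diffTable_false_zero_right w N).symm fun n => ?_
  linarith [diffTable_false_succ_right w N n]

theorem newtonDiff_true {x : ℝ} (h0 : 0 ≤ x) (h1 : x ≤ 1) (w : List Bool) (N : ℕ) :
    (x + (N + 1)) * newtonDiff (true :: w) N x = newton w (N + 1) x := by
  have hs : Summable fun n => (fun n => Nat.casesOn n ((N + 1) * diffTable (true :: w) N 0)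
      (fun n => -diffTable w (N + 1) n) : ℕ → ℝ) n * sbinom x n := by
    rw [← summable_nat_add_iff 1]
    simpa using summable_mul_sbinom h0 h1 w (N + 1)
  rw [newtonDiff, tsum_shift_sbinom h0 h1 (tendsto_diffTable_right _ _)
    (summable_mul_sbinom' h0 h1 _ _) hs rfl, hs.tsum_eq_zero_add, newton, sum_diffTable_left]
  · simp [sbinom]
  · intro n
    have h2 := diffTable_pascal (true :: w) N n
    have h3 := diffTable_true_succ_left w N n
    simp only
    linear_combination h3 - (N + n + 2 : ℝ) * h2

theorem newton_zero_zero (w : List Bool) : newton w 0 0 = 0 := by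
  simp [newton, sbinom_succ_eq_prod]

theorem newton_at_zero (w : List Bool) (N : ℕ) :
    newton w N 0 = ∑ i ∈ Finset.range N, diffTable w i 0 := by
  simp [newton, sbinom_succ_eq_prod]

theorem newton_at_zero_nonneg (w : List Bool) (N : ℕ) : 0 ≤ newton w N 0 := by
  rw [newton_at_zero]; exact Finset.sum_nonneg fun _ _ => diffTable_nonneg _ _ _

theorem newton_at_zero_le (w : List Bool) (N : ℕ) :
    newton w N 0 ≤ harm (N + 1) ^ (w.length + 1) := by
  rw [newton_at_zero]
  refine (Finset.sum_le_sum fun i _ => diffTable_left_le w i).trans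
    ((sum_harm_pow_div_le _ _).trans (pow_le_pow_left₀ (harm_nonneg _) (harm_mono (by omega)) _))

theorem newton_sub_nonneg {x : ℝ} (h0 : 0 ≤ x) (h1 : x ≤ 1) (w : List Bool) (N : ℕ) :
    0 ≤ newton w N x - newton w N 0 := by
  rw [newton_at_zero, newton, add_sub_cancel_left]
  exact tsum_nonneg fun n => mul_nonneg (diffTable_nonneg _ _ _) (sbinom_succ_nonpos h0 h1 n)

theorem newton_sub_le {x : ℝ} (h0 : 0 ≤ x) (h1 : x ≤ 1) (w : List Bool) (N : ℕ) :
    newton w N x - newton w N 0 ≤ harm (N + 1) ^ w.length / ((N : ℝ) + 1) := by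
  rw [newton_at_zero, newton, add_sub_cancel_left]
  refine le_trans ?_ (diffTable_left_le w N)
  calc ∑' n, diffTable w N n * -sbinom x (n + 1)
      ≤ ∑' n, diffTable w N 0 * -sbinom x (n + 1) :=
        (summable_mul_sbinom h0 h1 w N).tsum_le_tsum
          (fun n => mul_le_mul_of_nonneg_right (diffTable_le_right_zero w N n)
            (sbinom_succ_nonpos h0 h1 n)) ((summable_sbinom h0 h1).mul_left _)
    _ = diffTable w N 0 * ∑' n, -sbinom x (n + 1) := tsum_mul_left
    _ ≤ _ := mul_le_of_le_one_right (diffTable_nonneg _ _ _) (tsum_sbinom_le h0 h1)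

/-- The linear extension of a real function of indices to formal combinations. -/
noncomputable def evalL (φ : List ℕ → ℝ) (v : List ℕ →₀ ℚ) : ℝ :=
  v.sum fun k a => (a : ℝ) * φ k

section evalL

variable (φ : List ℕ → ℝ)

@[simp] theorem evalL_zero : evalL φ 0 = 0 := Finsupp.sum_zero_index

@[simp] theorem evalL_single (k : List ℕ) (a : ℚ) :
    evalL φ (Finsupp.single k a) = a * φ k :=
  Finsupp.sum_single_index (by simp)

@[simp] theorem evalL_add (v w : List ℕ →₀ ℚ) : evalL φ (v + w) = evalL φ v + evalL φ w :=
  Finsupp.sum_add_index' (by simp) (by intros; push_cast; ring)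

@[simp] theorem evalL_sub (v w : List ℕ →₀ ℚ) : evalL φ (v - w) = evalL φ v - evalL φ w :=
  Finsupp.sum_sub_index (by intros; push_cast; ring)

@[simp] theorem evalL_smul (c : ℚ) (v : List ℕ →₀ ℚ) : evalL φ (c • v) = c * evalL φ v := by
  rw [evalL, Finsupp.sum_smul_index' (by simp), evalL, Finsupp.mul_sum]
  simp [mul_assoc]

@[simp] theorem evalL_mapDomain (f : List ℕ → List ℕ) (v : List ℕ →₀ ℚ) :
    evalL φ (Finsupp.mapDomain f v) = evalL (fun k => φ (f k)) v :=
  Finsupp.sum_mapDomain_index (by simp) (by intros; push_cast; ring)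

@[simp] theorem evalL_zero_fun (v : List ℕ →₀ ℚ) : evalL (fun _ => 0) v = 0 := by
  simp [evalL]

theorem evalL_finsupp_sum (v : List ℕ →₀ ℚ) (F : List ℕ → List ℕ →₀ ℚ) :
    evalL φ (v.sum fun k a => a • F k) = evalL (fun k => evalL φ (F k)) v := by
  induction v using Finsupp.induction_linear with
  | zero => simp
  | add v w hv hw =>
    rw [Finsupp.sum_add_index' (by simp) (by intros; rw [add_smul]), evalL_add, hv, hw, evalL_add]
  | single k a => simp

variable {φ}

theorem evalL_congr {ψ : List ℕ → ℝ} {v : List ℕ →₀ ℚ} (h : ∀ k ∈ v.support, φ k = ψ k) :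
    evalL φ v = evalL ψ v :=
  Finset.sum_congr rfl fun k hk => by simp only [h k hk]

theorem evalL_const_mul (c : ℝ) (v : List ℕ →₀ ℚ) :
    evalL (fun k => c * φ k) v = c * evalL φ v := by
  simp only [evalL, Finsupp.sum, Finset.mul_sum]
  exact Finset.sum_congr rfl fun _ _ => by ring

theorem evalL_sum {ι : Type*} (s : Finset ι) (ψ : ι → List ℕ → ℝ) (v : List ℕ →₀ ℚ) :
    evalL (fun k => ∑ i ∈ s, ψ i k) v = ∑ i ∈ s, evalL (ψ i) v := by
  simp only [evalL, Finsupp.sum, Finset.mul_sum]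
  exact Finset.sum_comm

theorem evalL_sub_fun (ψ : List ℕ → ℝ) (v : List ℕ →₀ ℚ) :
    evalL (fun k => φ k - ψ k) v = evalL φ v - evalL ψ v := by
  simp only [evalL, Finsupp.sum, mul_sub, Finset.sum_sub_distrib]

theorem evalL_tendsto {ψ : ℕ → List ℕ → ℝ} {v : List ℕ →₀ ℚ}
    (h : ∀ k ∈ v.support, Tendsto (fun n => ψ n k) atTop (𝓝 (φ k))) :
    Tendsto (fun n => evalL (ψ n) v) atTop (𝓝 (evalL φ v)) :=
  tendsto_finsetSum _ fun k hk => (h k hk).const_mul _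

theorem evalL_hasSum {ι : Type*} {ψ : ι → List ℕ → ℝ} {v : List ℕ →₀ ℚ}
    (h : ∀ k ∈ v.support, HasSum (fun n => ψ n k) (φ k)) :
    HasSum (fun n => evalL (ψ n) v) (evalL φ v) :=
  hasSum_sum fun k hk => (h k hk).mul_left _

end evalL

/-- The word of star-sum operations encoding a reversed index. -/
def indexWord : List ℕ → List Bool
  | [] => []
  | [a] => List.replicate (a - 1) false
  | a :: b :: k => List.replicate (a - 1) false ++ true :: indexWord (b :: k)

/-- The Kawashima function of a reversed index at `N + x`. -/
noncomputable def kawa (N : ℕ) (x : ℝ) : List ℕ → ℝ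
  | [] => 1
  | a :: k => newton (indexWord (a :: k)) N x

theorem newtonDiff_replicate {x : ℝ} (h0 : 0 ≤ x) (h1 : x ≤ 1) (w : List Bool) (c N : ℕ) :
    (x + (N + 1)) ^ c * newtonDiff (List.replicate c false ++ w) N x = newtonDiff w N x := by
  induction c with
  | zero => simp
  | succ c ih =>
    rw [List.replicate_succ, List.cons_append, pow_succ, mul_assoc, newtonDiff_false h0 h1, ih]

theorem kawa_succ_sub {x : ℝ} (h0 : 0 ≤ x) (h1 : x ≤ 1) {a : ℕ} (ha : 0 < a) (k : List ℕ)
    (N : ℕ) :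
    (x + (N + 1)) ^ a * (kawa (N + 1) x (a :: k) - kawa N x (a :: k)) = kawa (N + 1) x k := by
  obtain ⟨c, rfl⟩ : ∃ c, a = c + 1 := ⟨a - 1, by omega⟩
  rw [kawa, kawa, newton_succ_sub h0 h1, pow_succ']
  cases k with
  | nil =>
    have := newtonDiff_replicate h0 h1 [] c N
    rw [List.append_nil] at this
    rw [indexWord, Nat.add_sub_cancel, mul_assoc, this, newtonDiff_nil h0 h1, kawa]
  | cons b k =>
    rw [indexWord, Nat.add_sub_cancel, mul_assoc, newtonDiff_replicate h0 h1,
      newtonDiff_true h0 h1, kawa]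

theorem kawa_zero_zero (a : ℕ) (k : List ℕ) : kawa 0 0 (a :: k) = 0 := newton_zero_zero _

theorem kawa_sub_bounds {x : ℝ} (h0 : 0 ≤ x) (h1 : x ≤ 1) (k : List ℕ) :
    ∃ d : ℕ, ∀ N, 0 ≤ kawa N x k - kawa N 0 k ∧
      kawa N x k - kawa N 0 k ≤ harm (N + 1) ^ d / ((N : ℝ) + 1) := by
  cases k with
  | nil => exact ⟨0, fun N => by simp only [kawa, sub_self, le_refl, true_and]; positivity⟩
  | cons a k =>
    exact ⟨_, fun N => ⟨newton_sub_nonneg h0 h1 _ N, newton_sub_le h0 h1 _ N⟩⟩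

theorem kawa_zero_bounds (k : List ℕ) :
    ∃ d : ℕ, ∀ N, 0 ≤ kawa N 0 k ∧ kawa N 0 k ≤ harm (N + 1) ^ d := by
  cases k with
  | nil => exact ⟨0, fun N => by simp [kawa]⟩
  | cons a k => exact ⟨_, fun N => ⟨newton_at_zero_nonneg _ N, newton_at_zero_le _ N⟩⟩

theorem tendsto_kawa_sub {x : ℝ} (h0 : 0 ≤ x) (h1 : x ≤ 1) (k : List ℕ) :
    Tendsto (fun N => kawa N x k - kawa N 0 k) atTop (𝓝 0) := by
  obtain ⟨d, hd⟩ := kawa_sub_bounds h0 h1 k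
  exact squeeze_zero (fun N => (hd N).1) (fun N => (hd N).2) (tendsto_harm_pow_div d)

theorem tendsto_kawa_sub_mul {x : ℝ} (h0 : 0 ≤ x) (h1 : x ≤ 1) (k l : List ℕ) :
    Tendsto (fun N => (kawa N x k - kawa N 0 k) * kawa N 0 l) atTop (𝓝 0) := by
  obtain ⟨d, hd⟩ := kawa_sub_bounds h0 h1 k
  obtain ⟨d', hd'⟩ := kawa_zero_bounds l
  refine squeeze_zero (fun N => mul_nonneg (hd N).1 (hd' N).1) (fun N => ?_)
    (tendsto_harm_pow_div (d + d'))
  rw [pow_add, mul_div_right_comm]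
  exact mul_le_mul (hd N).2 (hd' N).2 (hd' N).1 ((hd N).1.trans (hd N).2)

theorem tendsto_kawa_mul_sub {x : ℝ} (h0 : 0 ≤ x) (h1 : x ≤ 1) (k l : List ℕ) :
    Tendsto (fun N => kawa N x k * kawa N x l - kawa N 0 k * kawa N 0 l) atTop (𝓝 0) := by
  have := ((tendsto_kawa_sub_mul h0 h1 k l).add (tendsto_kawa_sub_mul h0 h1 l k)).add
    ((tendsto_kawa_sub h0 h1 k).mul (tendsto_kawa_sub h0 h1 l))
  simp only [mul_zero, add_zero] at this
  refine this.congr fun N => by ring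

/-- The Kawashima functions multiply according to the harmonic product `*̄`. -/
theorem evalL_kawa_hbarAux (k l : List ℕ) (hk : ∀ a ∈ k, 0 < a) (hl : ∀ a ∈ l, 0 < a)
    {x : ℝ} (h0 : 0 ≤ x) (h1 : x ≤ 1) (N : ℕ) :
    evalL (kawa N x) (hbarAux k l) = kawa N x k * kawa N x l := by
  induction k, l using hbarAux.induct generalizing N x with
  | case1 l => simp [hbarAux, kawa]
  | case2 a k => simp [hbarAux, kawa]
  | case3 a k b l ih1 ih2 ih3 =>
    have ha : 0 < a := hk a (by simp)
    have hb : 0 < b := hl b (by simp)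
    have hk' : ∀ c ∈ k, 0 < c := fun c hc => hk c (by simp [hc])
    have hl' : ∀ c ∈ l, 0 < c := fun c hc => hl c (by simp [hc])
    let D : ℕ → ℝ → ℝ := fun N x =>
      kawa N x (a :: k) * kawa N x (b :: l) - evalL (kawa N x) (hbarAux (a :: k) (b :: l))
    have hstep : ∀ (x : ℝ), 0 ≤ x → x ≤ 1 → ∀ N, D (N + 1) x = D N x := by
      intro x h0 h1 N
      have e : ∀ c, 0 < c → ∀ v,
          (x + (N + 1)) ^ c * (evalL (fun k => kawa (N + 1) x (c :: k)) v
            - evalL (fun k => kawa N x (c :: k)) v) = evalL (kawa (N + 1) x) v := by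
        intro c hc v
        rw [← evalL_sub_fun, ← evalL_const_mul]
        simp only [kawa_succ_sub h0 h1 hc]
      have e1 := e a ha (hbarAux k (b :: l))
      have e2 := e b hb (hbarAux (a :: k) l)
      have e3 := e (a + b) (by omega) (hbarAux k l)
      rw [ih1 hk' hl h0 h1] at e1
      rw [ih2 hk hl' h0 h1] at e2
      rw [ih3 hk' hl' h0 h1] at e3
      have ek := kawa_succ_sub h0 h1 ha k N
      have el := kawa_succ_sub h0 h1 hb l N
      simp only [D, hbarAux, evalL_add, evalL_sub, evalL_mapDomain]
      have hy : (0 : ℝ) < x + (N + 1) := by positivity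
      have hyy : (x + (N + 1)) ^ (a + b) ≠ 0 := by positivity
      apply mul_left_cancel₀ hyy
      rw [pow_add] at e3 ⊢
      linear_combination (x + (N + 1)) ^ b * kawa (N + 1) x (b :: l) * ek
        + (x + (N + 1)) ^ a * kawa (N + 1) x (a :: k) * el
        - (x + (N + 1)) ^ b * (kawa (N + 1) x (b :: l) - kawa N x (b :: l)) * ek
        - kawa (N + 1) x k * el - (x + (N + 1)) ^ b * e1 - (x + (N + 1)) ^ a * e2 + e3
    have hconst : ∀ (x : ℝ), 0 ≤ x → x ≤ 1 → ∀ N, D N x = D 0 x := fun x h0 h1 N => by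
      induction N with
      | zero => rfl
      | succ N ih => rw [hstep x h0 h1, ih]
    have hD0 : D 0 0 = 0 := by
      simp [D, hbarAux, kawa_zero_zero]
    have hlim : Tendsto (fun N => D N x - D N 0) atTop (𝓝 0) := by
      have h2 := evalL_tendsto (φ := fun _ => 0) (v := hbarAux (a :: k) (b :: l))
        (fun j _ => tendsto_kawa_sub h0 h1 j)
      have h3 := (tendsto_kawa_mul_sub h0 h1 (a :: k) (b :: l)).sub h2
      rw [evalL_zero_fun, sub_zero] at h3
      refine h3.congr fun N => ?_
      rw [evalL_sub_fun]; simp only [D]; ring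
    have hDx : D 0 x = 0 := by
      refine tendsto_nhds_unique ?_ hlim
      simp only [hconst x h0 h1, hconst 0 le_rfl zero_le_one, hD0, sub_zero]
      exact tendsto_const_nhds
    have := hconst x h0 h1 N
    rw [hDx] at this
    simp only [D] at this
    linarith

/-- The truncated multiple harmonic sum `Σ_{0 < m_1 < ⋯ < m_r ≤ n}` of a reversed index. -/
noncomputable def msum : List ℕ → ℕ → ℝ
  | [], _ => 1
  | a :: k, n => ∑ j ∈ Finset.range n, 1 / ((j : ℝ) + 1) ^ a * msum k j

theorem msum_nonneg (k : List ℕ) (n : ℕ) : 0 ≤ msum k n := by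
  induction k generalizing n with
  | nil => simp [msum]
  | cons a k ih => exact Finset.sum_nonneg fun j _ => mul_nonneg (by positivity) (ih j)

theorem msum_cons_zero (a : ℕ) (k : List ℕ) : msum (a :: k) 0 = 0 := by simp [msum]

theorem msum_cons_succ (a : ℕ) (k : List ℕ) (n : ℕ) :
    msum (a :: k) (n + 1) = msum (a :: k) n + 1 / ((n : ℝ) + 1) ^ a * msum k n := by
  simp only [msum, Finset.sum_range_succ]

theorem hasSum_msum_replicate (y : ℝ) (n : ℕ) :
    HasSum (fun m => y ^ m * msum (List.replicate m 1) n)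
      (∏ j ∈ Finset.range n, (1 + y / (j + 1))) := by
  induction n with
  | zero =>
    convert hasSum_single 0 fun m hm => ?_ using 1
    · simp [msum]
    · obtain ⟨m, rfl⟩ := Nat.exists_eq_succ_of_ne_zero hm
      simp [List.replicate_succ, msum_cons_zero]
  | succ n ih =>
    have h1 : HasSum
        (fun m => Nat.casesOn m 0 (fun m => y ^ m * msum (List.replicate m 1) n) : ℕ → ℝ)
        (∏ j ∈ Finset.range n, (1 + y / (j + 1))) :=
      (hasSum_nat_add_iff' 1).1 (by simpa using ih)
    have h2 := ih.add (h1.mul_left (y / (n + 1)))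
    rw [Finset.prod_range_succ]
    convert h2 using 1
    · ext m
      cases m with
      | zero => simp [msum]
      | succ m =>
        simp only [List.replicate_succ, msum_cons_succ, pow_succ]
        field_simp
    · ring

theorem prod_one_add_sq_le (n : ℕ) :
    (∏ j ∈ Finset.range n, (1 + (1 / 2 : ℝ) / (j + 1))) ^ 2 ≤ 2 * n + 1 := by
  induction n with
  | zero => simp
  | succ n ih =>
    rw [Finset.prod_range_succ, mul_pow]
    calc _ ≤ (2 * n + 1 : ℝ) * (1 + 1 / 2 / (n + 1)) ^ 2 := by gcongr
      _ ≤ _ := by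
        push_cast
        have : (1 + 1 / 2 / ((n : ℝ) + 1)) = (2 * n + 3) / (2 * (n + 1)) := by
          field_simp; ring
        rw [this, div_pow, mul_div_assoc', div_le_iff₀ (by positivity)]
        have : (0 : ℝ) ≤ n := by positivity
        nlinarith

theorem prod_one_add_le {x : ℝ} (h0 : 0 ≤ x) (h1 : x ≤ 1 / 2) (n : ℕ) :
    ∏ j ∈ Finset.range n, (1 + x / ((j : ℝ) + 1)) ≤ 2 * ((n : ℝ) + 1) ^ (1 / 2 : ℝ) := by
  calc ∏ j ∈ Finset.range n, (1 + x / ((j : ℝ) + 1))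
      ≤ ∏ j ∈ Finset.range n, (1 + (1 / 2 : ℝ) / (j + 1)) := by
        refine Finset.prod_le_prod (fun j _ => by positivity) fun j _ => by gcongr
    _ ≤ _ := by
        refine abs_le_of_sq_le_sq' ?_ (by positivity) |>.2
        refine (prod_one_add_sq_le n).trans ?_
        rw [mul_pow, ← Real.rpow_natCast (((n : ℝ) + 1) ^ (1 / 2 : ℝ)),
          ← Real.rpow_mul (by positivity)]
        norm_num
        linarith [n.cast_nonneg (α := ℝ)]

theorem summable_mul_prod {x : ℝ} (h0 : 0 ≤ x) (h1 : x ≤ 1 / 2) (w : List Bool) :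
    Summable fun n : ℕ => diffTable w 0 n * (x / (n + 1)) *
      ∏ j ∈ Finset.range n, (1 + x / ((j : ℝ) + 1)) := by
  obtain ⟨C, hC0, hC⟩ := exists_harm_pow_le w.length
  have hs : Summable fun n : ℕ => 2 * C * ((n : ℝ) + 1) ^ (-(5 / 4) : ℝ) := by
    have := (summable_nat_add_iff 1).2
      (Real.summable_nat_rpow.2 (by norm_num : (-(5 / 4) : ℝ) < -1))
    simpa using this.mul_left (2 * C)
  have hP : ∀ n : ℕ, 0 ≤ ∏ j ∈ Finset.range n, (1 + x / ((j : ℝ) + 1)) := fun n =>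
    Finset.prod_nonneg fun j _ => by positivity
  refine Summable.of_nonneg_of_le (fun n => mul_nonneg
    (mul_nonneg (diffTable_nonneg _ _ _) (by positivity)) (hP n)) (fun n => ?_) hs
  have hn : (0 : ℝ) < (n : ℝ) + 1 := by positivity
  calc diffTable w 0 n * (x / (n + 1)) * ∏ j ∈ Finset.range n, (1 + x / ((j : ℝ) + 1))
      ≤ (C * ((n : ℝ) + 1) ^ (1 / 4 : ℝ) / (n + 1)) * (1 / (n + 1)) *
          (2 * ((n : ℝ) + 1) ^ (1 / 2 : ℝ)) := by
        refine mul_le_mul (mul_le_mul ?_ ?_ (by positivity) (by positivity))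
          (prod_one_add_le h0 h1 n) (hP n) (by positivity)
        · exact (diffTable_right_le w n).trans (by gcongr; exact hC n)
        · gcongr; linarith
    _ = 2 * C * (((n : ℝ) + 1) ^ (1 / 4 : ℝ) * ((n : ℝ) + 1) ^ (1 / 2 : ℝ) /
          ((n : ℝ) + 1) ^ (2 : ℝ)) := by rw [Real.rpow_two]; field_simp
    _ = _ := by rw [← Real.rpow_add hn, ← Real.rpow_sub hn]; norm_num

/-- The value `ζ((1,…,1)_{m+1} ⊛ (k∨)⋆)` for the index `k` encoded by a word. -/
noncomputable def zetaWord (w : List Bool) (m : ℕ) : ℝ :=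
  ∑' n : ℕ, diffTable w 0 n * (1 / ((n : ℝ) + 1) * msum (List.replicate m 1) n)

/-- The Taylor coefficients of the Kawashima function of a word at `0`. -/
noncomputable def taylorCoeff (w : List Bool) : ℕ → ℝ
  | 0 => 0
  | m + 1 => (-1) ^ m * zetaWord w m

theorem hasSum_tsum_swap {f : ℕ × ℕ → ℝ} (hf : Summable f) :
    HasSum (fun m => ∑' n, f (n, m)) (∑' n, ∑' m, f (n, m)) := by
  rw [← Summable.tsum_comm (f := fun n m => f (n, m)) hf]
  exact hf.prod_symm.prod.hasSum

/-- The terms of the double series expanding the Newton series of a word in powers of `x`. -/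
noncomputable def taylorTerm (w : List Bool) (x : ℝ) (p : ℕ × ℕ) : ℝ :=
  diffTable w 0 p.1 * (x / (p.1 + 1)) * ((-x) ^ p.2 * msum (List.replicate p.2 1) p.1)

theorem norm_taylorTerm {x : ℝ} (h0 : 0 ≤ x) (w : List Bool) (n m : ℕ) :
    ‖taylorTerm w x (n, m)‖ =
      diffTable w 0 n * (x / (n + 1)) * (x ^ m * msum (List.replicate m 1) n) := by
  have h2 := diffTable_nonneg w 0 n
  have h3 := msum_nonneg (List.replicate m 1) n
  have h4 : 0 ≤ x / ((n : ℝ) + 1) := by positivity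
  simp only [taylorTerm, norm_mul, norm_pow, norm_neg, Real.norm_of_nonneg h0,
    Real.norm_of_nonneg h2, Real.norm_of_nonneg h3, Real.norm_of_nonneg h4]

theorem summable_taylorTerm {x : ℝ} (h0 : 0 ≤ x) (h1 : x ≤ 1 / 2) (w : List Bool) :
    Summable (taylorTerm w x) := by
  refine Summable.of_norm ((summable_prod_of_nonneg fun p => norm_nonneg _).2 ⟨fun n => ?_, ?_⟩)
  · simp only [norm_taylorTerm h0]
    exact (hasSum_msum_replicate x n).summable.mul_left _
  · simp only [norm_taylorTerm h0, tsum_mul_left, (hasSum_msum_replicate x _).tsum_eq]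
    exact summable_mul_prod h0 h1 w

theorem tsum_taylorTerm_left (x : ℝ) (w : List Bool) (m : ℕ) :
    ∑' n, taylorTerm w x (n, m) = taylorCoeff w (m + 1) * x ^ (m + 1) := by
  rw [taylorCoeff, zetaWord, ← tsum_mul_left, ← tsum_mul_right]
  refine tsum_congr fun n => ?_
  rw [taylorTerm, neg_pow]
  ring

theorem tsum_taylorTerm_right (x : ℝ) (w : List Bool) :
    ∑' n, ∑' m, taylorTerm w x (n, m) = newton w 0 x := by
  rw [newton, Finset.range_zero, Finset.sum_empty, zero_add]
  refine tsum_congr fun n => ?_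
  simp only [taylorTerm]
  rw [tsum_mul_left, (hasSum_msum_replicate (-x) n).tsum_eq, sbinom_succ_eq_prod]
  simp only [neg_div, ← sub_eq_add_neg]
  ring

theorem hasSum_taylorCoeff {x : ℝ} (h0 : 0 ≤ x) (h1 : x ≤ 1 / 2) (w : List Bool) :
    HasSum (fun m => taylorCoeff w m * x ^ m) (newton w 0 x) := by
  have h := hasSum_tsum_swap (summable_taylorTerm h0 h1 w)
  rw [tsum_taylorTerm_right] at h
  simp only [tsum_taylorTerm_left] at h
  simpa [taylorCoeff] using (hasSum_nat_add_iff (f := fun m => taylorCoeff w m * x ^ m) 1).1 h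

theorem eq_zero_of_hasSum_pow {c : ℕ → ℝ}
    (h : ∀ x : ℝ, 0 ≤ x → x ≤ 1 / 2 → HasSum (fun m => c m * x ^ m) 0) (m : ℕ) : c m = 0 := by
  let p : FormalMultilinearSeries ℝ ℝ ℝ := FormalMultilinearSeries.ofScalars ℝ c
  have hp : 0 < p.radius := by
    have hs := (h (1 / 2) (by norm_num) le_rfl).summable.norm
    refine lt_of_lt_of_le ?_ (p.le_radius_of_summable (r := 1 / 2) ?_)
    · simp
    · refine hs.of_nonneg_of_le (fun n => by positivity) fun n => ?_
      rw [norm_mul, norm_pow]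
      simp [p]
  have hf := p.hasFPowerSeriesOnBall hp
  have ha : AnalyticAt ℝ p.sum 0 := hf.analyticAt
  have hfr : ∃ᶠ z in 𝓝[≠] (0 : ℝ), p.sum z = 0 := by
    have hev : ∀ᶠ z : ℝ in 𝓝[>] 0, p.sum z = 0 := by
      filter_upwards [Ioc_mem_nhdsGT (by norm_num : (0 : ℝ) < 1 / 2)] with z hz
      have := (h z hz.1.le hz.2).tsum_eq
      simpa [FormalMultilinearSeries.sum, p, mul_comm] using this
    exact hev.frequently.filter_mono (nhdsWithin_mono _ fun z hz => ne_of_gt hz)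
  have h0 := ha.frequently_zero_iff_eventually_zero.1 hfr
  have : p = 0 := HasFPowerSeriesAt.eq_zero (hf.hasFPowerSeriesAt.congr h0)
  have h3 : p.coeff m = c m := by simp [p]
  rw [← h3, this]
  simp [FormalMultilinearSeries.coeff]

/-- Comparison of Taylor coefficients in the multiplicativity of Kawashima functions. -/
theorem sum_taylorCoeff_mul (k l : List ℕ) (hk : ∀ a ∈ k, 0 < a) (hl : ∀ a ∈ l, 0 < a)
    (hk0 : k ≠ []) (hl0 : l ≠ []) (hkl : ∀ j ∈ (hbarAux k l).support, j ≠ []) (m : ℕ) :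
    ∑ p ∈ Finset.HasAntidiagonal.antidiagonal m,
      taylorCoeff (indexWord k) p.1 * taylorCoeff (indexWord l) p.2 =
      evalL (fun j => taylorCoeff (indexWord j) m) (hbarAux k l) := by
  have hkw : ∀ j : List ℕ, j ≠ [] → ∀ x, kawa 0 x j = newton (indexWord j) 0 x := by
    intro j hj x
    cases j with
    | nil => exact absurd rfl hj
    | cons a j => rfl
  rw [← sub_eq_zero]
  refine eq_zero_of_hasSum_pow (c := fun m => ∑ p ∈ Finset.HasAntidiagonal.antidiagonal m,
      taylorCoeff (indexWord k) p.1 * taylorCoeff (indexWord l) p.2 -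
      evalL (fun j => taylorCoeff (indexWord j) m) (hbarAux k l)) (fun x h0 h1 => ?_) m
  have ek := hasSum_taylorCoeff h0 h1 (indexWord k)
  have el := hasSum_taylorCoeff h0 h1 (indexWord l)
  have sk := ek.summable.norm
  have sl := el.summable.norm
  have e1 := (summable_norm_sum_mul_antidiagonal_of_summable_norm sk sl).of_norm.hasSum
  rw [← tsum_mul_tsum_eq_tsum_sum_antidiagonal_of_summable_norm sk sl, ek.tsum_eq, el.tsum_eq] at e1
  have e2 : HasSum (fun m => evalL (fun j => taylorCoeff (indexWord j) m * x ^ m) (hbarAux k l))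
      (evalL (kawa 0 x) (hbarAux k l)) := evalL_hasSum fun j hj => by
    rw [hkw j (hkl j hj)]; exact hasSum_taylorCoeff h0 h1 _
  rw [evalL_kawa_hbarAux k l hk hl h0 (by linarith), hkw k hk0, hkw l hl0] at e2
  have e3 := e1.sub e2
  rw [sub_self] at e3
  refine e3.congr_fun fun n => ?_
  rw [sub_mul, Finset.sum_mul, mul_comm (evalL _ _), ← evalL_const_mul]
  congr 1
  · refine Finset.sum_congr rfl fun p hp => ?_
    rw [← Finset.HasAntidiagonal.mem_antidiagonal.1 hp, pow_add]; ring
  · simp only [mul_comm]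

/-- The reversed index encoded by a word. -/
def wordIndex : List Bool → List ℕ
  | [] => [1]
  | true :: w => 1 :: wordIndex w
  | false :: w => (wordIndex w).modifyHead (· + 1)

theorem exists_wordIndex_eq_cons (w : List Bool) : ∃ a r, wordIndex w = a :: r := by
  induction w with
  | nil => exact ⟨_, _, rfl⟩
  | cons b w ih =>
    obtain ⟨a, r, h⟩ := ih
    cases b <;> simp [wordIndex, h]

theorem pos_of_mem_wordIndex (w : List Bool) : ∀ x ∈ wordIndex w, 0 < x := by
  induction w with
  | nil => simp [wordIndex]
  | cons b w ih =>
    obtain ⟨a, r, h⟩ := exists_wordIndex_eq_cons w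
    cases b <;> simp_all [wordIndex]

theorem wordIndex_ne_nil (w : List Bool) : wordIndex w ≠ [] := by
  obtain ⟨a, r, h⟩ := exists_wordIndex_eq_cons w
  simp [h]

theorem sum_wordIndex (w : List Bool) : (wordIndex w).sum = w.length + 1 := by
  induction w with
  | nil => rfl
  | cons b w ih =>
    obtain ⟨a, r, h⟩ := exists_wordIndex_eq_cons w
    rw [h, List.sum_cons] at ih
    cases b <;> simp [wordIndex, h] <;> omega

theorem wordIndex_replicate_append (c : ℕ) (w : List Bool) :
    wordIndex (List.replicate c false ++ w) = (wordIndex w).modifyHead (· + c) := by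
  induction c with
  | zero => obtain ⟨a, r, h⟩ := exists_wordIndex_eq_cons w; simp [h]
  | succ c ih =>
    obtain ⟨a, r, h⟩ := exists_wordIndex_eq_cons w
    simp [List.replicate_succ, wordIndex, ih, h, add_assoc]

theorem wordIndex_indexWord (k : List ℕ) (hk0 : k ≠ []) (hk : ∀ a ∈ k, 0 < a) :
    wordIndex (indexWord k) = k := by
  induction k with
  | nil => exact absurd rfl hk0
  | cons a k ih =>
    have ha : 1 + (a - 1) = a := by have := hk a (by simp); omega
    cases k with
    | nil =>
      have h := wordIndex_replicate_append (a - 1) []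
      rw [List.append_nil] at h
      simp [indexWord, h, wordIndex, ha]
    | cons b k =>
      rw [indexWord, wordIndex_replicate_append, wordIndex,
        ih (by simp) fun x hx => hk x (List.mem_cons_of_mem _ hx)]
      simp [ha]

/-- The nonempty partial sums of a list, shifted by `c`. -/
def partialSums (c : ℕ) : List ℕ → List ℕ
  | [] => []
  | a :: l => (c + a) :: partialSums (c + a) l

theorem zipWith_partialSums (c : ℕ) (l : List ℕ) :
    (partialSums c l).zipWith (fun a b => a - b) (c :: partialSums c l) = l := by
  induction l generalizing c with
  | nil => rfl
  | cons a l ih => simp [partialSums, ih]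

theorem mem_partialSums {c x : ℕ} {l : List ℕ} :
    x ∈ partialSums c l ↔ ∃ i ∈ Finset.Ico 1 (l.length + 1), c + (l.take i).sum = x := by
  induction l generalizing c with
  | nil => simp [partialSums]
  | cons a l ih =>
    simp only [partialSums, List.mem_cons, ih, Finset.mem_Ico]
    constructor
    · rintro (rfl | ⟨i, hi, rfl⟩)
      · exact ⟨1, by simp, by simp⟩
      · exact ⟨i + 1, by simp; omega, by simp [add_assoc]⟩
    · rintro ⟨i, hi, rfl⟩
      obtain ⟨i, rfl⟩ : ∃ j, i = j + 1 := ⟨i - 1, by omega⟩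
      rcases Nat.eq_zero_or_pos i with rfl | h
      · simp
      · exact Or.inr ⟨i, ⟨h, by simpa using hi.2⟩, by simp [add_assoc]⟩

theorem partialSums_sorted (c : ℕ) {l : List ℕ} (hl : ∀ a ∈ l, 0 < a) :
    (partialSums c l).Pairwise (· < ·) := by
  induction l generalizing c with
  | nil => exact List.Pairwise.nil
  | cons a l ih =>
    refine List.Pairwise.cons (fun x hx => ?_) (ih _ fun b hb => hl b (List.mem_cons_of_mem _ hb))
    obtain ⟨i, hi, rfl⟩ := mem_partialSums.1 hx
    obtain ⟨h1, h2⟩ := Finset.mem_Ico.1 hi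
    cases l with
    | nil => simp at h2; omega
    | cons b l =>
      obtain ⟨i, rfl⟩ : ∃ j, i = j + 1 := ⟨i - 1, by omega⟩
      have := hl b (by simp)
      simp only [List.take_succ_cons, List.sum_cons]
      omega

theorem sort_toFinset_partialSums {l : List ℕ} (hl : ∀ a ∈ l, 0 < a) :
    (partialSums 0 l).toFinset.sort (· ≤ ·) = partialSums 0 l :=
  (List.toFinset_sort (· ≤ ·) ((partialSums_sorted 0 hl).imp fun h => ne_of_lt h)).2
    ((partialSums_sorted 0 hl).imp fun h => le_of_lt h)

theorem partialSums_append (c a : ℕ) (l : List ℕ) :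
    partialSums c (l ++ [a]) = partialSums c l ++ [c + l.sum + a] := by
  induction l generalizing c with
  | nil => simp [partialSums]
  | cons b l ih => simp [partialSums, ih, add_assoc]

theorem Aset_append (l : List ℕ) (a : ℕ) : Aset (l ++ [a]) = (partialSums 0 l).toFinset := by
  ext x
  simp only [Aset, Finset.mem_image, List.mem_toFinset, mem_partialSums, List.length_append,
    List.length_singleton, zero_add]
  refine exists_congr fun i => and_congr_right fun hi => ?_
  rw [List.take_append_of_le_length (by have := (Finset.mem_Ico.1 hi).2; omega)]

/-- The set of positions of the letter `true` in a word, counted from the end. -/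
def truePositions : List Bool → Finset ℕ
  | [] => ∅
  | true :: w => insert (w.length + 1) (truePositions w)
  | false :: w => truePositions w

theorem truePositions_le {w : List Bool} {x : ℕ} (hx : x ∈ truePositions w) :
    1 ≤ x ∧ x ≤ w.length := by
  induction w with
  | nil => simp [truePositions] at hx
  | cons b w ih =>
    rw [List.length_cons]
    cases b with
    | true =>
      rcases Finset.mem_insert.1 hx with rfl | hx
      · omega
      · have := ih hx; omega
    | false => have := ih hx; omega

theorem Icc_sdiff_truePositions (w : List Bool) :
    Finset.Icc 1 w.length \ truePositions w = truePositions (w.map not) := by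
  induction w with
  | nil => simp [truePositions]
  | cons b w ih =>
    have hw : ∀ x, x ∈ truePositions w → x ≤ w.length := fun x hx => (truePositions_le hx).2
    ext x
    have hx := hw x
    have ihx := congrArg (x ∈ ·) ih
    simp only [Finset.mem_sdiff, Finset.mem_Icc, eq_iff_iff] at ihx
    cases b <;> simp [truePositions, ← ihx] <;> grind

theorem Aset_wordIndex_reverse (w : List Bool) :
    Aset (wordIndex w).reverse = truePositions w := by
  induction w with
  | nil => simp [wordIndex, truePositions, Aset]
  | cons b w ih =>
    obtain ⟨a, r, h⟩ := exists_wordIndex_eq_cons w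
    have hs := sum_wordIndex w
    rw [h, List.reverse_cons, Aset_append] at ih
    rw [h, List.sum_cons] at hs
    cases b with
    | true =>
      rw [wordIndex, h, List.reverse_cons, Aset_append, truePositions, List.reverse_cons,
        partialSums_append, ← ih, ← hs]
      ext x
      simp [add_comm]
    | false =>
      rw [wordIndex, h, List.modifyHead_cons, List.reverse_cons, Aset_append, truePositions, ih]

theorem hdual_wordIndex_reverse (w : List Bool) :
    hdual (wordIndex w).reverse = (wordIndex (w.map not)).reverse := by
  have hset : insert (w.length + 1) (truePositions (w.map not)) =
      (partialSums 0 (wordIndex (w.map not)).reverse).toFinset := by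
    have := Aset_wordIndex_reverse (true :: w.map not)
    rw [wordIndex, List.reverse_cons, Aset_append, truePositions, List.length_map] at this
    exact this.symm
  rw [hdual]
  simp only [List.sum_reverse, sum_wordIndex, Nat.add_sub_cancel, Aset_wordIndex_reverse,
    Icc_sdiff_truePositions, hset]
  rw [sort_toFinset_partialSums fun x hx => pos_of_mem_wordIndex _ x (List.mem_reverse.1 hx),
    zipWith_partialSums]

theorem hdual_reverse (k : List ℕ) (hk0 : k ≠ []) (hk : ∀ a ∈ k, 0 < a) :
    hdual k.reverse = (wordIndex ((indexWord k).map not)).reverse := by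
  rw [← hdual_wordIndex_reverse, wordIndex_indexWord k hk0 hk]

theorem evalL_starOp_append (φ : List ℕ → ℝ) (b a : ℕ) :
    ∀ l : List ℕ, evalL φ (starOp (l ++ [b, a])) =
      evalL (fun j => φ (j ++ [a])) (starOp (l ++ [b])) + evalL φ (starOp (l ++ [b + a]))
  | [] => by simp [starOp]
  | [c] => by simp [starOp, add_assoc, add_left_comm]
  | c :: d :: l => by
    have h1 := evalL_starOp_append (fun j => φ (c :: j)) b a (d :: l)
    have h2 := evalL_starOp_append φ b a ((c + d) :: l)
    simp only [List.cons_append] at h1 h2 ⊢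
    simp only [starOp, evalL_add, evalL_mapDomain, h1, h2, List.cons_append]
    ring
  termination_by l => l.length

/-- The value of a function of reversed indices on `k⋆`, for a reversed index `k`. -/
noncomputable def evalStar (ψ : List ℕ → ℝ) (k : List ℕ) : ℝ :=
  evalL (fun j => ψ j.reverse) (starOp k.reverse)

theorem evalStar_singleton (ψ : List ℕ → ℝ) (a : ℕ) : evalStar ψ [a] = ψ [a] := by
  simp [evalStar, starOp]

theorem evalStar_cons_cons (ψ : List ℕ → ℝ) (a b : ℕ) (k : List ℕ) :
    evalStar ψ (a :: b :: k) =
      evalStar (fun j => ψ (a :: j)) (b :: k) + evalStar ψ ((b + a) :: k) := by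
  simp only [evalStar, List.reverse_cons, List.append_assoc, List.singleton_append]
  simp [evalL_starOp_append]

theorem evalStar_succ (ψ : List ℕ → ℝ) (a : ℕ) (k : List ℕ) :
    evalStar ψ ((a + 1) :: k) = evalStar (fun j => ψ (j.modifyHead (· + 1))) (a :: k) := by
  induction k generalizing a with
  | nil => simp [evalStar_singleton]
  | cons b k ih => rw [evalStar_cons_cons, evalStar_cons_cons, ← add_assoc, ih]; rfl

theorem hasSum_evalStar {ψ : ℕ → List ℕ → ℝ} {φ : List ℕ → ℝ} {k : List ℕ} (hk0 : k ≠ [])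
    (hk : ∀ a ∈ k, 0 < a)
    (h : ∀ j : List ℕ, j ≠ [] → (∀ a ∈ j, 0 < a) → HasSum (fun n => ψ n j) (φ j)) :
    HasSum (fun n => evalStar (ψ n) k) (evalStar φ k) := by
  obtain ⟨a, r, rfl⟩ := List.exists_cons_of_ne_nil hk0
  clear hk0
  induction r generalizing a ψ φ with
  | nil => simpa only [evalStar_singleton] using h [a] (by simp) hk
  | cons b r ih =>
    simp only [evalStar_cons_cons]
    simp only [List.forall_mem_cons] at hk
    exact (ih (fun j _ hj => h (a :: j) (by simp) (List.forall_mem_cons.2 ⟨hk.1, hj⟩)) b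
      (List.forall_mem_cons.2 hk.2)).add
      (ih h (b + a) (List.forall_mem_cons.2 ⟨by omega, hk.2.2⟩))

theorem evalStar_congr {ψ φ : List ℕ → ℝ} {a : ℕ} {k : List ℕ}
    (h : ∀ j : List ℕ, j ≠ [] → ψ j = φ j) : evalStar ψ (a :: k) = evalStar φ (a :: k) := by
  induction k generalizing a ψ φ with
  | nil => simpa only [evalStar_singleton] using h [a] (by simp)
  | cons b k ih =>
    rw [evalStar_cons_cons, evalStar_cons_cons, ih h, ih fun j _ => h (a :: j) (by simp)]

theorem evalStar_const_mul (c : ℝ) (ψ : List ℕ → ℝ) (k : List ℕ) :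
    evalStar (fun j => c * ψ j) k = c * evalStar ψ k :=
  evalL_const_mul c _

/-- The terms of the series for the multiple zeta value of a reversed index. -/
noncomputable def zetaTerm (n : ℕ) : List ℕ → ℝ
  | [] => 0
  | a :: k => 1 / ((n : ℝ) + 1) ^ a * msum k n

theorem sum_zetaTerm (k : List ℕ) (hk : k ≠ []) (n : ℕ) :
    msum k n = ∑ i ∈ Finset.range n, zetaTerm i k := by
  cases k with
  | nil => exact absurd rfl hk
  | cons a k => rfl

theorem zetaTerm_modifyHead (n : ℕ) (k : List ℕ) :
    zetaTerm n (k.modifyHead (· + 1)) = 1 / ((n : ℝ) + 1) * zetaTerm n k := by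
  cases k with
  | nil => simp [zetaTerm]
  | cons a k => simp only [List.modifyHead_cons, zetaTerm, pow_succ]; field_simp

theorem evalStar_zetaTerm_succ (n a : ℕ) (k : List ℕ) :
    evalStar (zetaTerm n) ((a + 1) :: k) = 1 / ((n : ℝ) + 1) * evalStar (zetaTerm n) (a :: k) := by
  simp only [evalStar_succ, zetaTerm_modifyHead, evalStar_const_mul]

/-- Star sums of a word are the zeroth column of its difference table. -/
theorem evalStar_zetaTerm (w : List Bool) (n : ℕ) :
    evalStar (zetaTerm n) (wordIndex w) = diffTable w n 0 := by
  induction w generalizing n with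
  | nil =>
    rw [wordIndex, evalStar_singleton, zetaTerm, diffTable]
    simp [msum, Nat.factorial_succ]
    have := Nat.factorial_pos n
    field_simp
  | cons b w ih =>
    obtain ⟨a, r, h⟩ := exists_wordIndex_eq_cons w
    rw [h] at ih
    cases b with
    | false =>
      rw [wordIndex, h, List.modifyHead_cons, evalStar_zetaTerm_succ, ih, diffTable]
      ring
    | true =>
      have h2 := sum_diffTable_left w n
      rw [wordIndex, h, evalStar_cons_cons, evalStar_zetaTerm_succ, ih]
      have e : evalStar (fun j => zetaTerm n (1 :: j)) (a :: r) =
          1 / ((n : ℝ) + 1) * ∑ i ∈ Finset.range n, diffTable w i 0 := by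
        rw [evalStar_congr (φ := fun j => 1 / ((n : ℝ) + 1) * ∑ i ∈ Finset.range n, zetaTerm i j)
          fun j hj => by rw [zetaTerm, sum_zetaTerm j hj, pow_one], evalStar_const_mul, evalStar,
          evalL_sum]
        simp only [← ih]
        rfl
      rw [e, ← mul_add, ← Finset.sum_range_succ, ← h2]
      field_simp

theorem msum_le_harm_pow (k : List ℕ) (hk : ∀ a ∈ k, 0 < a) (n : ℕ) :
    msum k n ≤ harm (n + 1) ^ k.length := by
  induction k generalizing n with
  | nil => simp [msum]
  | cons a k ih =>
    obtain ⟨ha, hk⟩ := List.forall_mem_cons.1 hk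
    calc msum (a :: k) n ≤ ∑ j ∈ Finset.range n, 1 / ((j : ℝ) + 1) * harm (n + 1) ^ k.length := by
          refine Finset.sum_le_sum fun j hj => ?_
          have hjn : j + 1 ≤ n + 1 := by have := Finset.mem_range.1 hj; omega
          refine mul_le_mul ?_ ((ih hk j).trans (pow_le_pow_left₀ (harm_nonneg _) (harm_mono hjn) _))
            (msum_nonneg _ _) (by positivity)
          exact one_div_le_one_div_of_le (by positivity)
            (le_self_pow₀ (by linarith [j.cast_nonneg (α := ℝ)]) (by omega))
      _ = harm n * harm (n + 1) ^ k.length := by rw [← Finset.sum_mul]; rfl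
      _ ≤ harm (n + 1) ^ (a :: k).length := by
          rw [List.length_cons, pow_succ']
          exact mul_le_mul_of_nonneg_right (harm_mono n.le_succ) (pow_nonneg (harm_nonneg _) _)

theorem summable_zetaTerm (c : ℕ) (k : List ℕ) (hc : 2 ≤ c) (hk : ∀ a ∈ k, 0 < a) :
    Summable fun n => zetaTerm n (c :: k) := by
  obtain ⟨C, hC0, hC⟩ := exists_harm_pow_le k.length
  have hs : Summable fun n : ℕ => C * ((n : ℝ) + 1) ^ (-(7 / 4) : ℝ) := by
    have := (summable_nat_add_iff 1).2
      (Real.summable_nat_rpow.2 (by norm_num : (-(7 / 4) : ℝ) < -1))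
    simpa using this.mul_left C
  refine hs.of_nonneg_of_le (fun n => mul_nonneg (by positivity) (msum_nonneg _ _)) fun n => ?_
  have hn : (0 : ℝ) < (n : ℝ) + 1 := by positivity
  calc zetaTerm n (c :: k) ≤ 1 / ((n : ℝ) + 1) ^ 2 * (C * ((n : ℝ) + 1) ^ (1 / 4 : ℝ)) := by
        refine mul_le_mul ?_ ((msum_le_harm_pow k hk n).trans (hC n)) (msum_nonneg _ _)
          (by positivity)
        exact one_div_le_one_div_of_le (by positivity)
          (pow_le_pow_right₀ (by linarith [n.cast_nonneg (α := ℝ)]) hc)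
    _ = C * (((n : ℝ) + 1) ^ (1 / 4 : ℝ) / ((n : ℝ) + 1) ^ (2 : ℝ)) := by
        rw [Real.rpow_two]; field_simp
    _ = _ := by rw [← Real.rpow_sub hn]; norm_num

/-- The terms of the series defining a multiple zeta value. -/
noncomputable def mzvTerm {r : ℕ} (f m : Fin r → ℕ) : ℝ :=
  if (∀ i, 0 < m i) ∧ (∀ i j, i < j → m i < m j) then ∏ i, 1 / (m i : ℝ) ^ f i else 0

theorem mzvTerm_nonneg {r : ℕ} (f m : Fin r → ℕ) : 0 ≤ mzvTerm f m := by
  rw [mzvTerm]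
  split_ifs
  · exact Finset.prod_nonneg fun i _ => by positivity
  · exact le_rfl

theorem mzvTerm_snoc_zero {r : ℕ} (f : Fin (r + 1) → ℕ) (m : Fin r → ℕ) :
    mzvTerm f (Fin.snoc m 0 : Fin (r + 1) → ℕ) = 0 :=
  if_neg fun h => by simpa using h.1 (Fin.last r)

theorem mzvTerm_snoc_succ {r : ℕ} (f : Fin (r + 1) → ℕ) (m : Fin r → ℕ) (c : ℕ) :
    mzvTerm f (Fin.snoc m (c + 1) : Fin (r + 1) → ℕ) =
      1 / ((c : ℝ) + 1) ^ f (Fin.last r) *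
        if ∀ i, m i ≤ c then mzvTerm (fun i => f i.castSucc) m else 0 := by
  have h : ((∀ i, 0 < (Fin.snoc m (c + 1) : Fin (r + 1) → ℕ) i) ∧
      (∀ i j, i < j → (Fin.snoc m (c + 1) : Fin (r + 1) → ℕ) i <
        (Fin.snoc m (c + 1) : Fin (r + 1) → ℕ) j)) ↔
      (∀ i, m i ≤ c) ∧ (∀ i, 0 < m i) ∧ (∀ i j, i < j → m i < m j) := by
    simp only [Fin.forall_fin_succ', Fin.snoc_castSucc, Fin.snoc_last, Fin.castSucc_lt_castSucc_iff,
      Fin.castSucc_lt_last, lt_irrefl, forall_true_left, Nat.lt_succ_iff]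
    have : ∀ i : Fin r, ¬ Fin.last r < i.castSucc := fun i => (Fin.castSucc_lt_last i).not_gt
    simp only [this, false_imp_iff, implies_true, and_true, Nat.zero_le, forall_and]
    tauto
  simp only [mzvTerm, h]
  by_cases h1 : ∀ i, m i ≤ c
  · simp only [h1, implies_true, true_and, if_true, mul_ite, mul_zero, Fin.prod_univ_castSucc,
      Fin.snoc_castSucc, Fin.snoc_last]
    push_cast
    rw [mul_comm]
  · simp only [h1, false_and, if_false, mul_zero]

theorem tsum_snoc_mzvTerm {r : ℕ} (f : Fin (r + 1) → ℕ) (p : (Fin (r + 1) → ℕ) → Prop)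
    [DecidablePred p] :
    ∑' m, (if p m then ENNReal.ofReal (mzvTerm f m) else 0) =
      ∑' c : ℕ, ENNReal.ofReal (1 / ((c : ℝ) + 1) ^ f (Fin.last r)) *
        ∑' m : Fin r → ℕ, if (∀ i, m i ≤ c) ∧ p (Fin.snoc m (c + 1) : Fin (r + 1) → ℕ) then
          ENNReal.ofReal (mzvTerm (fun i => f i.castSucc) m) else 0 := by
  rw [← (Fin.snocEquiv fun _ => ℕ).tsum_eq, ENNReal.summable.tsum_prod' fun _ => ENNReal.summable,
    tsum_eq_zero_add' ENNReal.summable]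
  simp only [Fin.snocEquiv, Equiv.coe_fn_mk, mzvTerm_snoc_zero, mzvTerm_snoc_succ,
    ENNReal.ofReal_zero, ite_self, tsum_zero, zero_add, ← ENNReal.tsum_mul_left]
  refine tsum_congr fun c => tsum_congr fun m => ?_
  rw [ENNReal.ofReal_mul (by positivity)]
  by_cases h1 : ∀ i, m i ≤ c <;> by_cases h2 : p (Fin.snoc m (c + 1) : Fin (r + 1) → ℕ) <;>
    simp [h1, h2]

theorem tsum_mzvTerm_le {r : ℕ} (f : Fin r → ℕ) (n : ℕ) :
    ∑' m : Fin r → ℕ, (if ∀ i, m i ≤ n then ENNReal.ofReal (mzvTerm f m) else 0) =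
      ENNReal.ofReal (msum (List.ofFn f).reverse n) := by
  induction r generalizing n with
  | zero => simp [tsum_fintype, mzvTerm, msum]
  | succ r ih =>
    have e : ∀ (c : ℕ) (m : Fin r → ℕ), ((∀ i, m i ≤ c) ∧
        ∀ i, (Fin.snoc m (c + 1) : Fin (r + 1) → ℕ) i ≤ n) ↔ (∀ i, m i ≤ c) ∧ c < n := by
      intro c m
      simp only [Fin.forall_fin_succ', Fin.snoc_castSucc, Fin.snoc_last]
      exact and_congr_right fun h => ⟨fun h' => h'.2, fun h' => ⟨fun i => (h i).trans (by omega), h'⟩⟩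
    rw [tsum_snoc_mzvTerm, List.ofFn_succ', List.concat_eq_append, List.reverse_append,
      List.reverse_singleton, List.singleton_append, msum, tsum_eq_sum (s := Finset.range n),
      ENNReal.ofReal_sum_of_nonneg fun j _ => mul_nonneg (by positivity) (msum_nonneg _ _)]
    · refine Finset.sum_congr rfl fun c hc => ?_
      rw [ENNReal.ofReal_mul (by positivity), ← ih]
      simp only [e, Finset.mem_range.1 hc, and_true]
    · intro c hc
      rw [Finset.mem_range] at hc
      simp only [e, hc, and_false, if_false, tsum_zero, mul_zero]

theorem tsum_mzvTerm {r : ℕ} (f : Fin r → ℕ) {c : ℕ} {k : List ℕ}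
    (h : List.ofFn f = (c :: k).reverse) : ∑' m, mzvTerm f m = ∑' n, zetaTerm n (c :: k) := by
  cases r with
  | zero => simp at h
  | succ r =>
    rw [List.ofFn_succ', List.concat_eq_append, List.reverse_cons] at h
    obtain ⟨h1, h2⟩ := List.append_inj' h rfl
    have h3 : f (Fin.last r) = c := by simpa using h2
    have := tsum_snoc_mzvTerm f fun _ => True
    simp only [if_true, and_true, tsum_mzvTerm_le, h1, List.reverse_reverse, h3] at this
    have h0 : ∀ n : ℕ, 0 ≤ 1 / ((n : ℝ) + 1) ^ c := fun n => by positivity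
    simp only [← ENNReal.ofReal_mul (h0 _)] at this
    have := congrArg ENNReal.toReal this
    rw [ENNReal.tsum_toReal_eq fun _ => ENNReal.ofReal_ne_top,
      ENNReal.tsum_toReal_eq fun _ => ENNReal.ofReal_ne_top] at this
    simpa only [ENNReal.toReal_ofReal (mzvTerm_nonneg _ _),
      ENNReal.toReal_ofReal (mul_nonneg (h0 _) (msum_nonneg _ _)), zetaTerm] using this

theorem mzv_reverse_cons (c : ℕ) (k : List ℕ) :
    mzv (c :: k).reverse = ∑' n, zetaTerm n (c :: k) :=
  tsum_mzvTerm (c :: k).reverse.get (List.ofFn_get _)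

theorem hasSum_mzv (c : ℕ) (k : List ℕ) (hc : 2 ≤ c) (hk : ∀ a ∈ k, 0 < a) :
    HasSum (fun n => zetaTerm n (c :: k)) (mzv (c :: k).reverse) :=
  mzv_reverse_cons c k ▸ (summable_zetaTerm c k hc hk).hasSum

theorem evalL_msum_hstarAux (k l : List ℕ) (n : ℕ) :
    evalL (fun j => msum j n) (hstarAux k l) = msum k n * msum l n := by
  induction k, l using hstarAux.induct generalizing n with
  | case1 l => simp [hstarAux, msum]
  | case2 a k => simp [hstarAux, msum]
  | case3 a k b l ih1 ih2 ih3 =>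
    induction n with
    | zero => simp [hstarAux, msum_cons_zero]
    | succ n ihn =>
      rw [hstarAux] at ihn ⊢
      simp only [evalL_add, evalL_mapDomain] at ihn ⊢
      have e : ∀ (c : ℕ) (v : List ℕ →₀ ℚ), evalL (fun j => msum (c :: j) (n + 1)) v =
          evalL (fun j => msum (c :: j) n) v +
            1 / ((n : ℝ) + 1) ^ c * evalL (fun j => msum j n) v := by
        intro c v
        rw [← evalL_const_mul, ← sub_eq_iff_eq_add', ← evalL_sub_fun]
        simp only [msum_cons_succ, add_sub_cancel_left]
      rw [e, e, e, ih1, ih2, ih3, msum_cons_succ, msum_cons_succ, pow_add]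
      linear_combination ihn

theorem pos_of_mem_support_mapDomain_cons {a : ℕ} (ha : 0 < a) {v : List ℕ →₀ ℚ}
    (hv : ∀ j ∈ v.support, ∀ x ∈ j, 0 < x) :
    ∀ j ∈ (Finsupp.mapDomain (List.cons a) v).support, ∀ x ∈ j, 0 < x := by
  intro j hj
  obtain ⟨i, hi, rfl⟩ := Finset.mem_image.1 (Finsupp.mapDomain_support hj)
  exact List.forall_mem_cons.2 ⟨ha, hv i hi⟩

theorem pos_of_mem_support_hstarAux (k l : List ℕ) (hk : ∀ a ∈ k, 0 < a) (hl : ∀ a ∈ l, 0 < a) :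
    ∀ j ∈ (hstarAux k l).support, ∀ x ∈ j, 0 < x := by
  induction k, l using hstarAux.induct with
  | case1 l => simpa [hstarAux, Finsupp.support_single] using hl
  | case2 a k => simpa [hstarAux, Finsupp.support_single] using hk
  | case3 a k b l ih1 ih2 ih3 =>
    obtain ⟨ha, hk'⟩ := List.forall_mem_cons.1 hk
    obtain ⟨hb, hl'⟩ := List.forall_mem_cons.1 hl
    rw [hstarAux]
    intro j hj
    rcases Finset.mem_union.1 (Finsupp.support_add hj) with hj | hj
    · rcases Finset.mem_union.1 (Finsupp.support_add hj) with hj | hj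
      · exact pos_of_mem_support_mapDomain_cons ha (ih1 hk' hl) j hj
      · exact pos_of_mem_support_mapDomain_cons hb (ih2 hk hl') j hj
    · exact pos_of_mem_support_mapDomain_cons (by omega) (ih3 hk' hl') j hj

theorem pos_of_mem_support_hbarAux (k l : List ℕ) (hk : ∀ a ∈ k, 0 < a) (hl : ∀ a ∈ l, 0 < a) :
    ∀ j ∈ (hbarAux k l).support, ∀ x ∈ j, 0 < x := by
  induction k, l using hbarAux.induct with
  | case1 l => simpa [hbarAux, Finsupp.support_single] using hl
  | case2 a k => simpa [hbarAux, Finsupp.support_single] using hk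
  | case3 a k b l ih1 ih2 ih3 =>
    obtain ⟨ha, hk'⟩ := List.forall_mem_cons.1 hk
    obtain ⟨hb, hl'⟩ := List.forall_mem_cons.1 hl
    rw [hbarAux]
    intro j hj
    rcases Finset.mem_union.1 (Finsupp.support_sub hj) with hj | hj
    · rcases Finset.mem_union.1 (Finsupp.support_add hj) with hj | hj
      · exact pos_of_mem_support_mapDomain_cons ha (ih1 hk' hl) j hj
      · exact pos_of_mem_support_mapDomain_cons hb (ih2 hk hl') j hj
    · exact pos_of_mem_support_mapDomain_cons (by omega) (ih3 hk' hl') j hj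

theorem ne_nil_of_mem_support_hbarAux {k l : List ℕ} (hk : k ≠ []) (hl : l ≠ []) :
    ∀ j ∈ (hbarAux k l).support, j ≠ [] := by
  obtain ⟨a, k, rfl⟩ := List.exists_cons_of_ne_nil hk
  obtain ⟨b, l, rfl⟩ := List.exists_cons_of_ne_nil hl
  have hcons : ∀ (a : ℕ) (v : List ℕ →₀ ℚ),
      ∀ j ∈ (Finsupp.mapDomain (List.cons a) v).support, j ≠ [] := by
    intro a v j hj
    obtain ⟨i, -, rfl⟩ := Finset.mem_image.1 (Finsupp.mapDomain_support hj)
    simp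
  rw [hbarAux]
  intro j hj
  rcases Finset.mem_union.1 (Finsupp.support_sub hj) with hj | hj
  · rcases Finset.mem_union.1 (Finsupp.support_add hj) with hj | hj
    · exact hcons _ _ j hj
    · exact hcons _ _ j hj
  · exact hcons _ _ j hj

theorem hasSum_zetaL_circAst (p : ℕ) (j : List ℕ) (hj0 : j ≠ []) (hj : ∀ a ∈ j, 0 < a) :
    HasSum (fun n : ℕ => 1 / ((n : ℝ) + 1) * msum (List.replicate p 1) n * zetaTerm n j)
      (zetaL (circAst (List.replicate (p + 1) 1) j.reverse)) := by
  obtain ⟨b, r, rfl⟩ := List.exists_cons_of_ne_nil hj0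
  obtain ⟨hb, hr⟩ := List.forall_mem_cons.1 hj
  have e : zetaL (circAst (List.replicate (p + 1) 1) (b :: r).reverse) =
      evalL (fun x => mzv ((1 + b) :: x).reverse) (hstarAux (List.replicate p 1) r) := by
    rw [circAst, List.reverse_replicate, List.reverse_reverse, List.replicate_succ]
    exact (evalL_mapDomain _ _ _).trans (evalL_mapDomain _ _ _)
  rw [e]
  refine (evalL_hasSum fun x hx => hasSum_mzv (1 + b) x (by omega)
    (pos_of_mem_support_hstarAux _ _ (by simp) hr x hx)).congr_fun fun n => ?_
  simp only [zetaTerm]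
  rw [evalL_const_mul, evalL_msum_hstarAux, pow_add]
  field_simp

theorem zetaL_circAstL_starOp (p : ℕ) (k : List ℕ) :
    zetaL (circAstL (Finsupp.single (List.replicate p 1) 1) (starOp k)) =
      evalStar (fun j => zetaL (circAst (List.replicate p 1) j.reverse)) k.reverse := by
  rw [circAstL, Finsupp.sum_single_index (by simp)]
  simp only [one_mul, evalStar, List.reverse_reverse]
  exact evalL_finsupp_sum _ _ _

/-- The series for the zeta values occurring in Kawashima's relation. -/
theorem zetaL_circAstL_hdual (p : ℕ) (k : List ℕ) (hk0 : k ≠ []) (hk : ∀ a ∈ k, 0 < a) :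
    zetaL (circAstL (Finsupp.single (List.replicate (p + 1) 1) 1) (starOp (hdual k.reverse))) =
      zetaWord (indexWord k) p := by
  rw [hdual_reverse k hk0 hk, zetaL_circAstL_starOp, List.reverse_reverse]
  have h := hasSum_evalStar (wordIndex_ne_nil _) (pos_of_mem_wordIndex ((indexWord k).map not))
    (hasSum_zetaL_circAst p)
  simp only [evalStar_const_mul, evalStar_zetaTerm, diffTable_swap] at h
  rw [← h.tsum_eq, zetaWord]
  exact tsum_congr fun n => mul_comm _ _

theorem zetaL_circAstL_starL (p : ℕ) (v : List ℕ →₀ ℚ) :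
    zetaL (circAstL (Finsupp.single (List.replicate p 1) 1) (starL v)) =
      evalL (fun k => zetaL (circAstL (Finsupp.single (List.replicate p 1) 1) (starOp k))) v := by
  have h : ∀ w : List ℕ →₀ ℚ, zetaL (circAstL (Finsupp.single (List.replicate p 1) 1) w) =
      evalL (fun j => zetaL (circAst (List.replicate p 1) j)) w := by
    intro w
    rw [circAstL, Finsupp.sum_single_index (by simp)]
    simp only [one_mul]
    exact evalL_finsupp_sum _ _ _
  simp only [h, starL]
  exact evalL_finsupp_sum _ _ _

/-- Kawashima's relation for multiple zeta values:
`Σ_{p+q=m, p,q≥1} ζ((1,…,1)_p ⊛ (k∨)⋆) ζ((1,…,1)_q ⊛ (l∨)⋆)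
  = -ζ((1,…,1)_m ⊛ ((k *̄ l)∨)⋆)`. -/
theorem kawashima_relation (k l : List ℕ) (hk : k ≠ []) (hl : l ≠ [])
    (hkp : ∀ x ∈ k, 0 < x) (hlp : ∀ x ∈ l, 0 < x) (m : ℕ) (hm : 1 ≤ m) :
    ∑ p ∈ Finset.Ico 1 m,
      zetaL (circAstL (Finsupp.single (List.replicate p 1) 1) (starOp (hdual k))) *
        zetaL (circAstL (Finsupp.single (List.replicate (m - p) 1) 1)
          (starOp (hdual l)))
      = - zetaL (circAstL (Finsupp.single (List.replicate m 1) 1)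
          (starL (Finsupp.mapDomain hdual (hbar k l)))) := by
  obtain ⟨m, rfl⟩ : ∃ n, m = n + 1 := ⟨m - 1, by omega⟩
  have hk' : ∀ x ∈ k.reverse, 0 < x := fun x hx => hkp x (List.mem_reverse.1 hx)
  have hl' : ∀ x ∈ l.reverse, 0 < x := fun x hx => hlp x (List.mem_reverse.1 hx)
  have hk0 : k.reverse ≠ [] := by simpa using hk
  have hl0 : l.reverse ≠ [] := by simpa using hl
  have hne := ne_nil_of_mem_support_hbarAux hk0 hl0
  have h := sum_taylorCoeff_mul k.reverse l.reverse hk' hl' hk0 hl0 hne (m + 1)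
  have hR : zetaL (circAstL (Finsupp.single (List.replicate (m + 1) 1) 1)
      (starL (Finsupp.mapDomain hdual (hbar k l)))) =
      evalL (fun j => zetaWord (indexWord j) m) (hbarAux k.reverse l.reverse) := by
    rw [zetaL_circAstL_starL, evalL_mapDomain, hbar, evalL_mapDomain]
    exact evalL_congr fun j hj => zetaL_circAstL_hdual m j (hne j hj)
      (pos_of_mem_support_hbarAux _ _ hk' hl' j hj)
  have hL : ∀ (j : List ℕ) (p : ℕ), j ≠ [] → (∀ x ∈ j.reverse, 0 < x) → 1 ≤ p →
      zetaL (circAstL (Finsupp.single (List.replicate p 1) 1) (starOp (hdual j))) =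
        (-1) ^ (p + 1) * taylorCoeff (indexWord j.reverse) p := by
    intro j p hj0 hj hp
    obtain ⟨p, rfl⟩ : ∃ q, p = q + 1 := ⟨p - 1, by omega⟩
    have := zetaL_circAstL_hdual p j.reverse (by simpa using hj0) hj
    rw [List.reverse_reverse] at this
    rw [this, taylorCoeff, ← mul_assoc, ← pow_add, Even.neg_one_pow ⟨p + 1, by ring⟩, one_mul]
  have hsum : ∑ p ∈ Finset.Ico 1 (m + 1), taylorCoeff (indexWord k.reverse) p *
      taylorCoeff (indexWord l.reverse) (m + 1 - p) =
      (-1) ^ m * evalL (fun j => zetaWord (indexWord j) m) (hbarAux k.reverse l.reverse) := by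
    rw [← evalL_const_mul]
    refine Eq.trans ?_ h
    rw [Finset.Nat.sum_antidiagonal_eq_sum_range_succ_mk, Finset.sum_range_succ,
      Finset.sum_range_eq_add_Ico _ m.succ_pos]
    simp only [taylorCoeff, Nat.sub_self, zero_mul, mul_zero, zero_add, add_zero]
  rw [hR]
  have hmul : ∀ p ∈ Finset.Ico 1 (m + 1),
      zetaL (circAstL (Finsupp.single (List.replicate p 1) 1) (starOp (hdual k))) *
        zetaL (circAstL (Finsupp.single (List.replicate (m + 1 - p) 1) 1) (starOp (hdual l))) =
      (-1) ^ (m + 1) * (taylorCoeff (indexWord k.reverse) p *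
        taylorCoeff (indexWord l.reverse) (m + 1 - p)) := by
    intro p hp
    obtain ⟨h1, h2⟩ := Finset.mem_Ico.1 hp
    rw [hL k p hk hk' h1, hL l (m + 1 - p) hl hl' (by omega), mul_mul_mul_comm, ← pow_add,
      show p + 1 + (m + 1 - p + 1) = m + 1 + 2 by omega, pow_add _ (m + 1) 2]
    norm_num
  rw [Finset.sum_congr rfl hmul, ← Finset.mul_sum, hsum, ← mul_assoc, ← pow_add,
    Odd.neg_one_pow ⟨m, by ring⟩]
  ring

end Kawashima
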